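/- Let N ≥ 2, p > 1, σ > 0, u_0 ∈ C_0(ℝ^N), and let w ∈ C_0(ℝ^N) ∩ L¹(ℝ^N) with ∫_{ℝ^N} w(x) dx > 0. Suppose u : [0,∞) × ℝ^N → ℝ is continuous, is continuously differentiable in t and twice continuously differentiable in x on (0,∞) × ℝ^N, satisfies ∂_t u = Δu + |u|^p + t^σ w(x) on (0,∞) × ℝ^N, and u(0,·) = u_0. Then there exist constants C > 0 and R₀ > 0 such that for all R ≥ R₀ and all T > 0, ∫_{ℝ^N} w(x) dx ≤ C ( T^{−σ} R^{N − 2p/(p−1)} + T^{−p/(p−1) − σ} R^N ). -/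

import Mathlib

open MeasureTheory Filter Set
open scoped ENNReal NNReal

noncomputable section

abbrev Eu (N : ℕ) := EuclideanSpace ℝ (Fin N)

def IsC0 {N : ℕ} (φ : Eu N → ℝ) : Prop :=
  Continuous φ ∧ Tendsto φ (cocompact (Eu N)) (nhds 0)

/-- The Laplacian of a function on ℝ^N, as the sum of second derivatives in the
coordinate directions. -/
noncomputable def lap {N : ℕ} (f : Eu N → ℝ) (x : Eu N) : ℝ :=
  ∑ i : Fin N, iteratedFDeriv ℝ 2 f x (fun _ : Fin 2 => EuclideanSpace.single i (1 : ℝ))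

/-- Directional derivative along the `i`-th basis vector. -/
def dd {N : ℕ} (i : Fin N) (f : Eu N → ℝ) (x : Eu N) : ℝ :=
  fderiv ℝ f x (EuclideanSpace.single i (1 : ℝ))

lemma dd_contDiff {N : ℕ} (i : Fin N) {f : Eu N → ℝ} {n m : WithTop ℕ∞} (hf : ContDiff ℝ m f)
    (h : n + 1 ≤ m) : ContDiff ℝ n (dd i f) :=
  (hf.fderiv_right h).clm_apply contDiff_const

lemma lap_eq_dd {N : ℕ} {f : Eu N → ℝ} (hf : ContDiff ℝ 2 f) (x : Eu N) :
    lap f x = ∑ i, dd i (dd i f) x := by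
  unfold lap
  refine Finset.sum_congr rfl fun i _ => ?_
  rw [iteratedFDeriv_two_apply]
  have h1 : DifferentiableAt ℝ (fderiv ℝ f) x :=
    ((hf.fderiv_right (m := 1) (by norm_num)).differentiable (by norm_num)).differentiableAt
  unfold dd
  rw [fderiv_clm_apply h1 (differentiableAt_const _)]
  simp

lemma dd_line {N : ℕ} {f : Eu N → ℝ} (hf : Differentiable ℝ f) (i : Fin N) (x : Eu N) (s : ℝ) :
    HasDerivAt (fun s : ℝ => f (x + s • EuclideanSpace.single i (1 : ℝ)))
      (dd i f (x + s • EuclideanSpace.single i (1 : ℝ))) s := by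
  have h1 : HasDerivAt (fun s : ℝ => x + s • (EuclideanSpace.single i (1 : ℝ) : Eu N))
      (EuclideanSpace.single i (1 : ℝ)) s := by
    simpa using ((hasDerivAt_id s).smul_const (EuclideanSpace.single i (1 : ℝ) : Eu N)).const_add x
  exact (hf.differentiableAt.hasFDerivAt).comp_hasDerivAt s h1

lemma dd_dd_line {N : ℕ} {f : Eu N → ℝ} (hf : ContDiff ℝ 2 f) (i : Fin N) (x : Eu N) :
    dd i (dd i f) x =
      deriv (deriv (fun s : ℝ => f (x + s • EuclideanSpace.single i (1 : ℝ)))) 0 := by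
  have h1 : deriv (fun s : ℝ => f (x + s • EuclideanSpace.single i (1 : ℝ))) =
      fun s => dd i f (x + s • EuclideanSpace.single i (1 : ℝ)) := by
    funext s
    exact (dd_line (hf.differentiable (by norm_num)) i x s).deriv
  rw [h1]
  have h2 := (dd_line ((dd_contDiff (n := 1) i hf (by norm_num)).differentiable (by norm_num))
    i x 0).deriv
  rw [h2]; simp

lemma lap_eq_line {N : ℕ} {f : Eu N → ℝ} (hf : ContDiff ℝ 2 f) (x : Eu N) :
    lap f x = ∑ i, deriv (deriv (fun s : ℝ => f (x + s • EuclideanSpace.single i (1 : ℝ)))) 0 := by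
  rw [lap_eq_dd hf]
  exact Finset.sum_congr rfl fun i _ => dd_dd_line hf i x

lemma lap_add {N : ℕ} {f g : Eu N → ℝ} (hf : ContDiff ℝ 2 f) (hg : ContDiff ℝ 2 g) (x : Eu N) :
    lap (fun y => f y + g y) x = lap f x + lap g x := by
  unfold lap
  have : (fun y => f y + g y) = f + g := rfl
  rw [this, ← Finset.sum_add_distrib]
  refine Finset.sum_congr rfl fun i _ => ?_
  rw [iteratedFDeriv_add_apply hf.contDiffAt hg.contDiffAt]
  rfl

lemma lap_const_mul {N : ℕ} {f : Eu N → ℝ} (hf : ContDiff ℝ 2 f) (c : ℝ) (x : Eu N) :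
    lap (fun y => c * f y) x = c * lap f x := by
  unfold lap
  have : (fun y => c * f y) = c • f := rfl
  rw [this, Finset.mul_sum]
  refine Finset.sum_congr rfl fun i _ => ?_
  rw [iteratedFDeriv_const_smul_apply hf.contDiffAt]
  rfl

lemma lap_sub {N : ℕ} {f g : Eu N → ℝ} (hf : ContDiff ℝ 2 f) (hg : ContDiff ℝ 2 g) (x : Eu N) :
    lap (fun y => f y - g y) x = lap f x - lap g x := by
  have h1 : (fun y => f y - g y) = fun y => f y + (-1) * g y := by funext y; ring
  rw [h1, lap_add hf (contDiff_const.mul hg), lap_const_mul hg]; ring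

lemma lap_continuous {N : ℕ} {f : Eu N → ℝ} (hf : ContDiff ℝ 2 f) : Continuous (lap f) := by
  have : lap f = fun x => ∑ i, dd i (dd i f) x := funext fun x => lap_eq_dd hf x
  rw [this]
  exact continuous_finsetSum _ fun i _ =>
    (dd_contDiff (n := 0) i (dd_contDiff (n := 1) i hf (by norm_num)) (by norm_num)).continuous

lemma deriv2_le_of_isLocalMax {g : ℝ → ℝ} {a : ℝ} (hg : ContinuousAt g a) (h : IsLocalMax g a) :
    deriv (deriv g) a ≤ 0 := by
  by_contra hc
  push Not at hc
  have hmin := isLocalMin_of_deriv_deriv_pos hc h.deriv_eq_zero hg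
  have heq : g =ᶠ[nhds a] fun _ => g a := by
    filter_upwards [h, hmin] with y h1 h2
    exact le_antisymm h1 h2
  have := heq.deriv.deriv_eq
  simp at this
  linarith

lemma lap_le_of_isLocalMax {N : ℕ} {f : Eu N → ℝ} (hf : ContDiff ℝ 2 f) {x : Eu N}
    (h : IsLocalMax f x) : lap f x ≤ 0 := by
  rw [lap_eq_line hf]
  refine Finset.sum_nonpos fun i _ => ?_
  have hc : Continuous (fun s : ℝ => x + s • (EuclideanSpace.single i (1 : ℝ) : Eu N)) := by
    fun_prop
  apply deriv2_le_of_isLocalMax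
  · exact (hf.continuous.comp hc).continuousAt
  · have ht : Tendsto (fun s : ℝ => x + s • (EuclideanSpace.single i (1 : ℝ) : Eu N)) (nhds 0)
        (nhds x) := by
      have := hc.tendsto 0
      simpa using this
    have := ht.eventually h
    filter_upwards [this] with s hs
    simpa using hs

lemma nonneg_of_left_max {g : ℝ → ℝ} {d a b : ℝ} (hg : HasDerivAt g d b) (hab : a < b)
    (h : ∀ t ∈ Icc a b, g t ≤ g b) : 0 ≤ d := by
  have h1 := (hasDerivAt_iff_tendsto_slope.1 hg).mono_left
    (nhdsWithin_mono b (s := Iio b) (fun t ht => ne_of_lt ht))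
  refine ge_of_tendsto h1 ?_
  filter_upwards [Ioo_mem_nhdsLT hab] with t ht
  rw [slope_def_field]
  exact div_nonneg_of_nonpos (by linarith [h t ⟨ht.1.le, ht.2.le⟩]) (by linarith [ht.2])

/-- The closed box. -/
def box (N : ℕ) (L : ℝ) : Set (Eu N) := {x | ∀ i, |x i| ≤ L}

lemma box_compact (N : ℕ) (L : ℝ) : IsCompact (box N L) := by
  have h1 : IsCompact (Set.univ.pi fun _ : Fin N => Icc (-L) L) :=
    isCompact_univ_pi fun _ => isCompact_Icc
  have h2 : box N L = (EuclideanSpace.equiv (Fin N) ℝ).toHomeomorph ⁻¹'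
      (Set.univ.pi fun _ : Fin N => Icc (-L) L) := by
    ext x
    simp [box, abs_le, Pi.le_def, forall_and]
  rw [h2, Homeomorph.isCompact_preimage]
  exact h1

/-- Weak maximum principle on a box for functions with pointwise derivatives. -/
lemma max_principle {N : ℕ} {a b L : ℝ} (W W' : ℝ → Eu N → ℝ)
    (hc : ContinuousOn (fun q : ℝ × Eu N => W q.1 q.2) (Icc a b ×ˢ box N L))
    (hx : ∀ t ∈ Ioc a b, ContDiff ℝ 2 (W t))
    (ht : ∀ t ∈ Ioc a b, ∀ x, HasDerivAt (fun τ => W τ x) (W' t x) t)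
    (hlt : ∀ t ∈ Ioc a b, ∀ x ∈ box N L, W' t x < lap (W t) x)
    (h0 : ∀ x ∈ box N L, W a x ≤ 0)
    (hb : ∀ t ∈ Icc a b, ∀ x ∈ box N L, (∃ i, |x i| = L) → W t x ≤ 0) :
    ∀ t ∈ Icc a b, ∀ x ∈ box N L, W t x ≤ 0 := by
  intro t htt x hxx
  have hK : IsCompact (Icc a b ×ˢ box N L) := isCompact_Icc.prod (box_compact N L)
  obtain ⟨⟨t₀, x₀⟩, ⟨hm1, hm2⟩, hmax⟩ := hK.exists_isMaxOn ⟨(t, x), ⟨htt, hxx⟩⟩ hc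
  simp only at hm1 hm2
  have hmax' : ∀ s ∈ Icc a b, ∀ y ∈ box N L, W s y ≤ W t₀ x₀ := fun s hs y hy =>
    hmax (show (s, y) ∈ Icc a b ×ˢ box N L from ⟨hs, hy⟩)
  by_contra hcon
  push Not at hcon
  have hpos : 0 < W t₀ x₀ := lt_of_lt_of_le hcon (hmax' t htt x hxx)
  have hat : a < t₀ := by
    rcases eq_or_lt_of_le hm1.1 with h | h
    · subst h; linarith [h0 x₀ hm2]
    · exact h
  have hInt : ∀ i, |x₀ i| < L := fun i => by
    rcases eq_or_lt_of_le (hm2 i) with h | h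
    · linarith [hb t₀ hm1 x₀ hm2 ⟨i, h⟩]
    · exact h
  have hmem : t₀ ∈ Ioc a b := ⟨hat, hm1.2⟩
  have h1 : 0 ≤ W' t₀ x₀ := nonneg_of_left_max (ht t₀ hmem x₀) hat
    fun s hs => hmax' s ⟨hs.1, hs.2.trans hm1.2⟩ x₀ hm2
  have h2 : lap (W t₀) x₀ ≤ 0 := by
    apply lap_le_of_isLocalMax (hx t₀ hmem)
    have : ∀ᶠ y in nhds x₀, ∀ i, |y i| < L := by
      rw [Filter.eventually_all]
      intro i
      have hci : Continuous fun y : Eu N => |y i| := by fun_prop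
      exact hci.continuousAt.eventually_lt continuousAt_const (hInt i)
    filter_upwards [this] with y hy
    exact hmax' t₀ hm1 y fun i => (hy i).le
  linarith [hlt t₀ hmem x₀ hm2]

/-- product of sines -/
def sn {N : ℕ} (κ : ℝ) (k : Fin N → ℤ) (x : Eu N) : ℝ :=
  ∏ i, Real.sin (k i * (κ * x i + Real.pi / 2))

lemma sn_contDiff {N : ℕ} (κ : ℝ) (k : Fin N → ℤ) {n : WithTop ℕ∞} :
    ContDiff ℝ n (sn (N := N) κ k) := by
  unfold sn
  apply contDiff_prod
  intro i _
  fun_prop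

lemma sn_line {N : ℕ} (κ : ℝ) (k : Fin N → ℤ) (x : Eu N) (i : Fin N) (s : ℝ) :
    sn κ k (x + s • EuclideanSpace.single i (1 : ℝ)) =
      (∏ j ∈ Finset.univ.erase i, Real.sin (k j * (κ * x j + Real.pi / 2))) *
        Real.sin (k i * (κ * (x i + s) + Real.pi / 2)) := by
  unfold sn
  rw [← Finset.mul_prod_erase _ _ (Finset.mem_univ i), mul_comm]
  congr 1
  · refine Finset.prod_congr rfl fun j hj => ?_
    have : j ≠ i := Finset.ne_of_mem_erase hj
    simp [this]
  · simp

lemma sn_lap {N : ℕ} (κ : ℝ) (k : Fin N → ℤ) (x : Eu N) :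
    lap (sn κ k) x = -(κ ^ 2 * ∑ i, (k i : ℝ) ^ 2) * sn κ k x := by
  rw [lap_eq_line (sn_contDiff κ k), Finset.mul_sum, ← Finset.sum_neg_distrib, Finset.sum_mul]
  refine Finset.sum_congr rfl fun i _ => ?_
  have h0 := sn_line κ k x i 0
  rw [zero_smul, add_zero, add_zero] at h0
  simp_rw [sn_line]
  rw [h0]
  set c := ∏ j ∈ Finset.univ.erase i, Real.sin (k j * (κ * x j + Real.pi / 2))
  have hin : ∀ s : ℝ, HasDerivAt (fun s : ℝ => (k i : ℝ) * (κ * (x i + s) + Real.pi / 2))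
      ((k i : ℝ) * κ) s := fun s => by
    have := ((((hasDerivAt_id s).const_add (x i)).const_mul κ).add_const (Real.pi / 2)).const_mul
      (k i : ℝ)
    simpa using this
  have h1 : deriv (fun s => c * Real.sin (k i * (κ * (x i + s) + Real.pi / 2))) =
      fun s => c * (Real.cos (k i * (κ * (x i + s) + Real.pi / 2)) * (k i * κ)) := by
    funext s
    exact ((hin s).sin.const_mul c).deriv
  rw [h1, (((hin 0).cos.mul_const (k i * κ)).const_mul c).deriv]
  simp
  ring

/-- basic right-hand sides -/
def bas {N : ℕ} (κ : ℝ) (m : ℕ) (k : Fin N → ℤ) (q : ℝ × Eu N) : ℝ :=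
  Real.exp ((m + 1) * q.1) * sn κ k q.2

def Sp (N : ℕ) (κ : ℝ) : Submodule ℝ (ℝ × Eu N → ℝ) :=
  Submodule.span ℝ (Set.range fun mk : ℕ × (Fin N → ℤ) => bas κ mk.1 mk.2)

lemma Sp_mul_exp {N : ℕ} {κ : ℝ} {Q : ℝ × Eu N → ℝ} (hQ : Q ∈ Sp N κ) :
    (fun q : ℝ × Eu N => Real.exp q.1) * Q ∈ Sp N κ := by
  unfold Sp at hQ
  induction hQ using Submodule.span_induction with
  | mem x hx =>
    obtain ⟨⟨m, k⟩, rfl⟩ := hx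
    refine Submodule.subset_span ⟨(m + 1, k), ?_⟩
    funext q
    simp only [bas, Pi.mul_apply, ← mul_assoc, ← Real.exp_add]
    congr 2
    push_cast; ring
  | zero => simp
  | add x y _ _ hx hy => rw [mul_add]; exact add_mem hx hy
  | smul c x _ hx => rw [mul_smul_comm]; exact Submodule.smul_mem _ _ hx

lemma sn_mul_sin {N : ℕ} (κ : ℝ) (k : Fin N → ℤ) (j : Fin N) (x : Eu N) :
    Real.sin (κ * x j) * sn κ k x = (-1 / 2) * (sn κ (Function.update k j (k j + 1)) x +
      sn κ (Function.update k j (k j - 1)) x) := by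
  have key : ∀ r : ℤ, sn κ (Function.update k j r) x =
      Real.sin (r * (κ * x j + Real.pi / 2)) *
      ∏ i ∈ Finset.univ.erase j, Real.sin (k i * (κ * x i + Real.pi / 2)) := by
    intro r
    unfold sn
    rw [← Finset.mul_prod_erase _ _ (Finset.mem_univ j)]
    congr 1
    · simp
    · refine Finset.prod_congr rfl fun i hi => ?_
      have : i ≠ j := Finset.ne_of_mem_erase hi
      simp [this]
  have h0 := key (k j)
  rw [Function.update_eq_self] at h0
  rw [key, key, h0]
  have hs : Real.sin (κ * x j) = - Real.cos (κ * x j + Real.pi / 2) := by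
    rw [Real.cos_add_pi_div_two]; ring
  rw [hs]
  set θ := κ * x j + Real.pi / 2
  push_cast
  rw [add_mul, sub_mul, one_mul, Real.sin_add, Real.sin_sub]
  ring

lemma Sp_mul_sin {N : ℕ} {κ : ℝ} (j : Fin N) {Q : ℝ × Eu N → ℝ} (hQ : Q ∈ Sp N κ) :
    (fun q : ℝ × Eu N => Real.sin (κ * q.2 j)) * Q ∈ Sp N κ := by
  unfold Sp at hQ
  induction hQ using Submodule.span_induction with
  | mem x hx =>
    obtain ⟨⟨m, k⟩, rfl⟩ := hx
    have h1 : bas κ m (Function.update k j (k j + 1)) ∈ Sp N κ :=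
      Submodule.subset_span ⟨(m, _), rfl⟩
    have h2 : bas κ m (Function.update k j (k j - 1)) ∈ Sp N κ :=
      Submodule.subset_span ⟨(m, _), rfl⟩
    have h3 := (Sp N κ).smul_mem (-1 / 2) (add_mem h1 h2)
    convert h3 using 1
    funext q
    simp only [bas, Pi.mul_apply, Pi.smul_apply, Pi.add_apply, smul_eq_mul]
    have := sn_mul_sin κ k j q.2
    linear_combination Real.exp ((m + 1) * q.1) * this
  | zero => simp
  | add x y _ _ hx hy => rw [mul_add]; exact add_mem hx hy
  | smul c x _ hx => rw [mul_smul_comm]; exact Submodule.smul_mem _ _ hx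

/-- solvability of the zero-data heat problem on the box -/
def Solvable {N : ℕ} (a L : ℝ) (g : ℝ × Eu N → ℝ) : Prop :=
  ∃ v : ℝ × Eu N → ℝ, ContDiff ℝ 2 v ∧
    (∀ t x, HasDerivAt (fun τ => v (τ, x)) (lap (fun y => v (t, y)) x + g (t, x)) t) ∧
    (∀ x, v (a, x) = 0) ∧ (∀ t x, (∃ i, |x i| = L) → v (t, x) = 0)

lemma slice_contDiff {N : ℕ} {v : ℝ × Eu N → ℝ} {n : WithTop ℕ∞} (hv : ContDiff ℝ n v) (t : ℝ) :
    ContDiff ℝ n (fun y => v (t, y)) := hv.comp (contDiff_const.prodMk contDiff_id)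

lemma sn_boundary {N : ℕ} {κ L : ℝ} (hκ : κ * L = Real.pi / 2) (k : Fin N → ℤ)
    (x : Eu N) (h : ∃ i, |x i| = L) : sn κ k x = 0 := by
  obtain ⟨i, hi⟩ := h
  refine Finset.prod_eq_zero (Finset.mem_univ i) ?_
  rcases abs_choice (x i) with h | h
  · have : x i = L := by rw [← h, hi]
    rw [this, hκ]
    have : (k i : ℝ) * (Real.pi / 2 + Real.pi / 2) = k i * Real.pi := by ring
    rw [this, Real.sin_int_mul_pi]
  · have : x i = -L := by linarith
    rw [this]
    have : (k i : ℝ) * (κ * -L + Real.pi / 2) = 0 := by rw [mul_neg, hκ]; ring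
    rw [this, Real.sin_zero]

lemma solvable_bas {N : ℕ} {κ L a : ℝ} (hκ : κ * L = Real.pi / 2) (m : ℕ) (k : Fin N → ℤ) :
    Solvable a L (bas κ m k) := by
  set lam : ℝ := κ ^ 2 * ∑ i, (k i : ℝ) ^ 2 with hlam
  have hlam0 : 0 ≤ lam := by positivity
  have hne : (m : ℝ) + 1 + lam ≠ 0 := by positivity
  let c : ℝ → ℝ := fun t => (Real.exp ((m + 1) * t) -
    Real.exp ((m + 1 + lam) * a) * Real.exp (-lam * t)) / (m + 1 + lam)
  have hcd : ContDiff ℝ 2 c := by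
    unfold c
    fun_prop
  have hc : ∀ t, HasDerivAt c (-lam * c t + Real.exp ((m + 1) * t)) t := by
    intro t
    have h1 : HasDerivAt (fun t : ℝ => Real.exp ((m + 1) * t))
        (Real.exp ((m + 1) * t) * (m + 1)) t := by
      simpa using ((hasDerivAt_id t).const_mul ((m : ℝ) + 1)).exp
    have h2 : HasDerivAt (fun t : ℝ => Real.exp (-lam * t))
        (Real.exp (-lam * t) * (-lam)) t := by
      simpa using ((hasDerivAt_id t).const_mul (-lam)).exp
    have h3 := (h1.sub (h2.const_mul (Real.exp ((m + 1 + lam) * a)))).div_const (m + 1 + lam)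
    refine HasDerivAt.congr_deriv (f := c) h3 ?_
    simp only [c]
    field_simp
    ring
  refine ⟨fun q => c q.1 * sn κ k q.2, ?_, ?_, ?_, ?_⟩
  · exact (hcd.comp contDiff_fst).mul ((sn_contDiff κ k).comp contDiff_snd)
  · intro t x
    have h1 := (hc t).mul_const (sn κ k x)
    refine HasDerivAt.congr_deriv h1 ?_
    simp only
    rw [lap_const_mul (sn_contDiff κ k), sn_lap, bas]
    ring
  · intro x
    have : c a = 0 := by
      simp only [c]
      rw [← Real.exp_add]
      have : ((m : ℝ) + 1 + lam) * a + -lam * a = (m + 1) * a := by ring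
      rw [this]; simp
    simp [this]
  · intro t x h
    simp [sn_boundary hκ k x h]

lemma solvable_Sp {N : ℕ} {κ L a : ℝ} (hκ : κ * L = Real.pi / 2) {g : ℝ × Eu N → ℝ}
    (hg : g ∈ Sp N κ) : Solvable a L g := by
  unfold Sp at hg
  induction hg using Submodule.span_induction with
  | mem x hx =>
    obtain ⟨⟨m, k⟩, rfl⟩ := hx
    exact solvable_bas hκ m k
  | zero =>
    refine ⟨fun _ => 0, contDiff_const, ?_, by simp, by simp⟩
    intro t x
    have : lap (fun _ : Eu N => (0 : ℝ)) x = 0 := by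
      have := lap_const_mul (f := fun _ : Eu N => (0 : ℝ)) contDiff_const 0 x
      simpa using this
    rw [this]
    simpa using hasDerivAt_const t (0 : ℝ)
  | add g₁ g₂ _ _ h₁ h₂ =>
    obtain ⟨v₁, c₁, d₁, a₁, b₁⟩ := h₁
    obtain ⟨v₂, c₂, d₂, a₂, b₂⟩ := h₂
    refine ⟨fun q => v₁ q + v₂ q, c₁.add c₂, fun t x => ?_, fun x => by simp [a₁, a₂],
      fun t x h => by simp [b₁ t x h, b₂ t x h]⟩
    rw [lap_add (slice_contDiff c₁ t) (slice_contDiff c₂ t)]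
    refine HasDerivAt.congr_deriv ((d₁ t x).add (d₂ t x)) ?_
    simp only [Pi.add_apply]; ring
  | smul c g _ h =>
    obtain ⟨v₁, c₁, d₁, a₁, b₁⟩ := h
    refine ⟨fun q => c * v₁ q, contDiff_const.mul c₁, fun t x => ?_, fun x => by simp [a₁],
      fun t x h => by simp [b₁ t x h]⟩
    rw [lap_const_mul (slice_contDiff c₁ t)]
    refine HasDerivAt.congr_deriv ((d₁ t x).const_mul c) ?_
    simp only [Pi.smul_apply, smul_eq_mul]; ring

/-- The generators as continuous maps. -/
def gens (N : ℕ) (κ : ℝ) : Set C(ℝ × Eu N, ℝ) :=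
  insert ⟨fun q => Real.exp q.1, by fun_prop⟩
    (Set.range fun j : Fin N => ⟨fun q => Real.sin (κ * q.2 j), by fun_prop⟩)

lemma adjoin_contDiff {N : ℕ} {κ : ℝ} {Q : C(ℝ × Eu N, ℝ)} (hQ : Q ∈ Algebra.adjoin ℝ (gens N κ))
    {n : WithTop ℕ∞} : ContDiff ℝ n (Q : ℝ × Eu N → ℝ) := by
  induction hQ using Algebra.adjoin_induction with
  | mem x hx =>
    rcases hx with rfl | ⟨j, rfl⟩
    · exact Real.contDiff_exp.comp contDiff_fst
    · simp only [ContinuousMap.coe_mk]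
      have : ContDiff ℝ n fun q : ℝ × Eu N => q.2 j := by fun_prop
      exact Real.contDiff_sin.comp (contDiff_const.mul this)
  | algebraMap r => exact contDiff_const
  | add x y _ _ hx hy => exact hx.add hy
  | mul x y _ _ hx hy => exact hx.mul hy

lemma adjoin_mul_Sp {N : ℕ} {κ : ℝ} {Q : C(ℝ × Eu N, ℝ)}
    (hQ : Q ∈ Algebra.adjoin ℝ (gens N κ)) :
    ∀ g ∈ Sp N κ, (Q : ℝ × Eu N → ℝ) * g ∈ Sp N κ := by
  induction hQ using Algebra.adjoin_induction with
  | mem x hx =>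
    intro g hg
    rcases hx with rfl | ⟨j, rfl⟩
    · exact Sp_mul_exp hg
    · exact Sp_mul_sin j hg
  | algebraMap r =>
    intro g hg
    exact (Sp N κ).smul_mem r hg
  | add x y _ _ hx hy =>
    intro g hg
    rw [ContinuousMap.coe_add, add_mul]
    exact add_mem (hx g hg) (hy g hg)
  | mul x y _ _ hx hy =>
    intro g hg
    rw [ContinuousMap.coe_mul, mul_assoc]
    exact hx _ (hy g hg)

/-- Stone-Weierstrass for our algebra. -/
lemma approx {N : ℕ} {κ L a b : ℝ} (hL : 0 < L) (hκ : κ * L = Real.pi / 2)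
    (f : ℝ × Eu N → ℝ) (hf : ContinuousOn f (Icc a b ×ˢ box N L)) {ε : ℝ} (hε : 0 < ε) :
    ∃ Q ∈ Algebra.adjoin ℝ (gens N κ), ∀ q ∈ Icc a b ×ˢ box N L, |Q q - f q| ≤ ε := by
  set K : Set (ℝ × Eu N) := Icc a b ×ˢ box N L with hKdef
  have hK : IsCompact K := isCompact_Icc.prod (box_compact N L)
  have : CompactSpace K := isCompact_iff_compactSpace.1 hK
  have hκ0 : 0 < κ := by
    by_contra h
    push Not at h
    have := mul_nonpos_of_nonpos_of_nonneg h hL.le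
    linarith [Real.pi_pos]
  let r : C(ℝ × Eu N, ℝ) →⋆ₐ[ℝ] C(K, ℝ) :=
    ContinuousMap.compStarAlgHom' ℝ ℝ ⟨(Subtype.val), continuous_subtype_val⟩
  let A : Subalgebra ℝ C(K, ℝ) := Subalgebra.map (r : C(ℝ × Eu N, ℝ) →ₐ[ℝ] C(K, ℝ))
    (Algebra.adjoin ℝ (gens N κ))
  have hmemA : ∀ Q ∈ gens N κ, r Q ∈ A := fun Q hQ => ⟨Q, Algebra.subset_adjoin hQ, rfl⟩
  have hsep : A.SeparatesPoints := by
    intro p q hpq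
    by_cases h1 : p.1.1 = q.1.1
    · have h2 : p.1.2 ≠ q.1.2 := fun h => hpq (Subtype.ext (Prod.ext h1 h))
      have h3 : ∃ j, p.1.2 j ≠ q.1.2 j := by
        by_contra hh
        push Not at hh
        exact h2 (by ext j; exact hh j)
      obtain ⟨j, hj⟩ := h3
      refine ⟨_, ⟨_, hmemA _ (Or.inr ⟨j, rfl⟩), rfl⟩, ?_⟩
      intro h
      apply hj
      have hb : ∀ p : K, κ * p.1.2 j ∈ Icc (-(Real.pi / 2)) (Real.pi / 2) := by
        intro p
        have h5 := abs_le.1 (p.2.2 j)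
        rw [← hκ]
        constructor <;> nlinarith [h5.1, h5.2]
      have := Real.injOn_sin (hb p) (hb q) h
      exact mul_left_cancel₀ hκ0.ne' this
    · refine ⟨_, ⟨_, hmemA _ (Or.inl rfl), rfl⟩, ?_⟩
      intro h
      exact h1 (Real.exp_injective h)
  obtain ⟨⟨g, Q, hQ, hg⟩, hgf⟩ :=
    ContinuousMap.exists_mem_subalgebra_near_continuous_of_separatesPoints A hsep
      (K.domRestrict f) (continuousOn_iff_continuous_domRestrict.1 hf) ε hε
  refine ⟨Q, hQ, fun q hq => ?_⟩
  have := hgf ⟨q, hq⟩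
  simp only [← hg] at this
  exact this.le

lemma lap_sum_coord {N : ℕ} {ψ : ℝ → ℝ} (hψ : ContDiff ℝ 2 ψ) (x : Eu N) :
    lap (fun y : Eu N => ∑ i, ψ (y i)) x = ∑ i, deriv (deriv ψ) (x i) := by
  have hc : ContDiff ℝ 2 (fun y : Eu N => ∑ i, ψ (y i)) := by
    apply ContDiff.sum
    intro i _
    have : ContDiff ℝ 2 fun y : Eu N => y i := by fun_prop
    exact hψ.comp this
  rw [lap_eq_line hc]
  refine Finset.sum_congr rfl fun i _ => ?_
  have h1 : (fun s : ℝ => ∑ j, ψ ((x + s • (EuclideanSpace.single i (1 : ℝ) : Eu N)) j)) =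
      fun s => (∑ j ∈ Finset.univ.erase i, ψ (x j)) + ψ (x i + s) := by
    funext s
    rw [← Finset.add_sum_erase _ _ (Finset.mem_univ i), add_comm]
    congr 1
    · refine Finset.sum_congr rfl fun j hj => ?_
      have : j ≠ i := Finset.ne_of_mem_erase hj
      simp [this]
    · simp
  rw [h1]
  have h2 : deriv (fun s => (∑ j ∈ Finset.univ.erase i, ψ (x j)) + ψ (x i + s)) =
      fun s => deriv ψ (x i + s) := by
    funext s
    rw [deriv_const_add, deriv_comp_const_add]
  rw [h2, deriv_comp_const_add]
  simp

lemma barrier {L κ ε : ℝ} (hL : 0 < L) (hκ : κ * L = Real.pi / 2) (hε : 0 < ε) (M : ℝ) :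
    ∃ ψ : ℝ → ℝ, ContDiff ℝ 2 ψ ∧
      (∀ y, |y| ≤ L → 0 ≤ ψ y ∧ ψ y ≤ ε ∧ deriv (deriv ψ) y ≤ 0) ∧
      ∃ δ : ℝ, 0 < δ ∧ δ ≤ 1 / 2 ∧
        ∀ y, |y| ≤ L → Real.cos (κ * y) < δ → deriv (deriv ψ) y ≤ -M := by
  have hκ0 : 0 < κ := by
    by_contra h
    push Not at h
    have := mul_nonpos_of_nonpos_of_nonneg h hL.le
    linarith [Real.pi_pos]
  obtain ⟨n, hn⟩ := exists_nat_gt ((M + 1) * L ^ 2 / ε)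
  let m : ℕ := 2 * (n + 1)
  let ψ : ℝ → ℝ := fun y => ε * (1 - (y / L) ^ m)
  have hm2 : m - 1 - 1 = 2 * n := by omega
  have d1 : deriv ψ = fun y => ε * (-((m : ℝ) * (y / L) ^ (m - 1) * (1 / L))) := by
    funext y
    have := ((((hasDerivAt_id y).div_const L).pow m).const_sub 1).const_mul ε
    exact this.deriv
  have d2 : deriv (deriv ψ) = fun y =>
      ε * (-((m : ℝ) * (((m - 1 : ℕ) : ℝ) * (y / L) ^ (2 * n) * (1 / L)) * (1 / L))) := by
    rw [d1]
    funext y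
    have := ((((((hasDerivAt_id y).div_const L).pow (m - 1)).const_mul (m : ℝ)).mul_const
      (1 / L)).neg).const_mul ε
    rw [← hm2]
    exact this.deriv
  have hc2 : Continuous (deriv (deriv ψ)) := by
    rw [d2]; fun_prop
  refine ⟨ψ, by unfold ψ; fun_prop, ?_, ?_⟩
  · intro y hy
    have h1 : 0 ≤ (y / L) ^ m := by
      show 0 ≤ (y / L) ^ (2 * (n + 1))
      rw [pow_mul]; positivity
    have h2 : (y / L) ^ m ≤ 1 := by
      have h3 : |(y / L) ^ m| ≤ 1 := by
        rw [abs_pow, abs_div, abs_of_pos hL]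
        exact pow_le_one₀ (by positivity) ((div_le_one hL).2 hy)
      exact (abs_le.1 h3).2
    refine ⟨?_, ?_, ?_⟩
    · show 0 ≤ ε * (1 - (y / L) ^ m)
      exact mul_nonneg hε.le (by linarith)
    · show ε * (1 - (y / L) ^ m) ≤ ε
      nlinarith
    · rw [d2]
      have h4 : 0 ≤ (y / L) ^ (2 * n) := by rw [pow_mul]; positivity
      have : 0 ≤ ε * ((m : ℝ) * (((m - 1 : ℕ) : ℝ) * (y / L) ^ (2 * n) * (1 / L)) * (1 / L)) := by
        positivity
      simp only
      linarith
  · have hend : ∀ y, |y| = L → deriv (deriv ψ) y < -M := by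
      intro y hy
      rw [d2]
      have h1 : (y / L) ^ (2 * n) = 1 := by
        rw [pow_mul, div_pow, ← sq_abs, hy, div_self (by positivity), one_pow]
      simp only [h1]
      have hm1 : ((m - 1 : ℕ) : ℝ) = 2 * n + 1 := by
        have : m - 1 = 2 * n + 1 := by omega
        rw [this]; push_cast; ring
      have hm0 : (m : ℝ) = 2 * n + 2 := by
        have : m = 2 * n + 2 := by omega
        rw [this]; push_cast; ring
      rw [hm1, hm0]
      rw [div_lt_iff₀ hε] at hn
      have hn0 : (0 : ℝ) ≤ n := Nat.cast_nonneg n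
      have h5 : M * L ^ 2 < ε * ((2 * n + 2) * (2 * n + 1)) := by nlinarith [mul_nonneg hε.le hn0, mul_nonneg hε.le (mul_nonneg hn0 hn0), sq_nonneg L]
      have h6 : M < ε * ((2 * n + 2) * (2 * n + 1)) / L ^ 2 := by
        rw [lt_div_iff₀ (by positivity)]; exact h5
      have h7 : ε * (-((2 * (n : ℝ) + 2) * ((2 * n + 1) * 1 * (1 / L)) * (1 / L))) =
        -(ε * ((2 * n + 2) * (2 * n + 1)) / L ^ 2) := by field_simp
      rw [h7]; linarith
    let Z : Set ℝ := Icc (-L) L ∩ {y | -M ≤ deriv (deriv ψ) y}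
    have hZ : IsCompact Z := isCompact_Icc.inter_right (isClosed_le continuous_const hc2)
    have hpos : ∀ y ∈ Z, 0 < Real.cos (κ * y) := by
      intro y hy
      have hlt : |y| < L := by
        rcases eq_or_lt_of_le (abs_le.2 hy.1) with h | h
        · have h8 := hend y h
          have h9 : -M ≤ deriv (deriv ψ) y := hy.2
          linarith
        · exact h
      rw [abs_lt] at hlt
      apply Real.cos_pos_of_mem_Ioo
      rw [← hκ]
      constructor <;> nlinarith [hlt.1, hlt.2]
    have hcosc : ContinuousOn (fun y => Real.cos (κ * y)) Z := by fun_prop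
    rcases Z.eq_empty_or_nonempty with hem | hne
    · refine ⟨1 / 2, by norm_num, le_refl _, fun y hy _ => ?_⟩
      by_contra hcon
      push Not at hcon
      have : y ∈ Z := ⟨abs_le.1 hy, hcon.le⟩
      rw [hem] at this; exact this
    · obtain ⟨y0, hy0, hmin⟩ := hZ.exists_isMinOn hne hcosc
      refine ⟨min (1 / 2) (Real.cos (κ * y0)), lt_min (by norm_num) (hpos y0 hy0),
        min_le_left _ _, fun y hy hcos => ?_⟩
      by_contra hcon
      push Not at hcon
      have hyZ : y ∈ Z := ⟨abs_le.1 hy, hcon.le⟩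
      have h1 : Real.cos (κ * y0) ≤ Real.cos (κ * y) := hmin hyZ
      linarith [min_le_right (1 / 2) (Real.cos (κ * y0))]

lemma dd_slice {N : ℕ} {V : ℝ × Eu N → ℝ} (hV : Differentiable ℝ V) (i : Fin N) (t : ℝ)
    (x : Eu N) :
    dd i (fun y => V (t, y)) x = fderiv ℝ V (t, x) (0, EuclideanSpace.single i (1 : ℝ)) := by
  unfold dd
  have h1 : HasFDerivAt (fun y : Eu N => (t, y)) (ContinuousLinearMap.inr ℝ ℝ (Eu N)) x :=
    hasFDerivAt_prodMk_right t x
  have h2 := (hV (t, x)).hasFDerivAt.comp x h1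
  have h3 : fderiv ℝ (fun y => V (t, y)) x = _ := h2.fderiv
  rw [h3]
  simp

lemma lap_slice_continuous {N : ℕ} {V : ℝ × Eu N → ℝ} (hV : ContDiff ℝ 2 V) :
    Continuous fun q : ℝ × Eu N => lap (fun y => V (q.1, y)) q.2 := by
  have h1 : (fun q : ℝ × Eu N => lap (fun y => V (q.1, y)) q.2) = fun q =>
      ∑ i, fderiv ℝ (fun r => fderiv ℝ V r (0, EuclideanSpace.single i (1 : ℝ))) q
        (0, EuclideanSpace.single i (1 : ℝ)) := by
    funext q
    rw [lap_eq_dd (slice_contDiff hV q.1)]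
    refine Finset.sum_congr rfl fun i _ => ?_
    have h2 : dd i (fun y => V (q.1, y)) = fun y =>
        (fun r => fderiv ℝ V r (0, EuclideanSpace.single i (1 : ℝ))) (q.1, y) :=
      funext fun y => dd_slice (hV.differentiable (by norm_num)) i q.1 y
    have h3 : ContDiff ℝ 1 (fun r => fderiv ℝ V r (0, EuclideanSpace.single i (1 : ℝ))) :=
      (hV.fderiv_right (m := 1) (by norm_num)).clm_apply contDiff_const
    rw [h2, dd_slice (h3.differentiable (by norm_num))]
  rw [h1]
  refine continuous_finsetSum _ fun i _ => ?_
  have h3 : ContDiff ℝ 1 (fun r => fderiv ℝ V r (0, EuclideanSpace.single i (1 : ℝ))) :=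
    (hV.fderiv_right (m := 1) (by norm_num)).clm_apply contDiff_const
  exact (h3.continuous_fderiv (by norm_num)).clm_apply continuous_const

lemma time_deriv {N : ℕ} {V : ℝ × Eu N → ℝ} (hV : Differentiable ℝ V) (t : ℝ) (x : Eu N) :
    HasDerivAt (fun τ => V (τ, x)) (fderiv ℝ V (t, x) (1, 0)) t := by
  have h1 : HasDerivAt (fun τ : ℝ => (τ, x)) ((1 : ℝ), (0 : Eu N)) t :=
    (hasDerivAt_id t).prodMk (hasDerivAt_const t x)
  exact (hV (t, x)).hasFDerivAt.comp_hasDerivAt t h1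

lemma compare {N : ℕ} {a b L ε : ℝ} (hε : 0 < ε)
    (D r : ℝ → Eu N → ℝ) (ψ : ℝ → ℝ) (hψ : ContDiff ℝ 2 ψ)
    (hψ1 : ∀ y, |y| ≤ L → 0 ≤ ψ y ∧ ψ y ≤ ε ∧ deriv (deriv ψ) y ≤ 0)
    (hc : ContinuousOn (fun q : ℝ × Eu N => D q.1 q.2) (Icc a b ×ˢ box N L))
    (hx : ∀ t ∈ Ioc a b, ContDiff ℝ 2 (D t))
    (ht : ∀ t ∈ Ioc a b, ∀ x, HasDerivAt (fun τ => D τ x) (lap (D t) x + r t x) t)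
    (hr : ∀ t ∈ Ioc a b, ∀ x ∈ box N L, r t x ≤ ε + ∑ i, -deriv (deriv ψ) (x i))
    (h0 : ∀ x ∈ box N L, D a x ≤ ε)
    (hb : ∀ t ∈ Icc a b, ∀ x ∈ box N L, (∃ i, |x i| = L) → D t x ≤ ε) :
    ∀ t ∈ Icc a b, ∀ x ∈ box N L, D t x ≤ ε * (1 + 2 * (b - a) + N) := by
  have hS : ContDiff ℝ 2 (fun y : Eu N => ∑ i, ψ (y i)) := by
    apply ContDiff.sum
    intro i _
    have : ContDiff ℝ 2 fun y : Eu N => y i := by fun_prop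
    exact hψ.comp this
  have hS0 : ∀ x ∈ box N L, 0 ≤ ∑ i, ψ (x i) := fun x hx =>
    Finset.sum_nonneg fun i _ => (hψ1 _ (hx i)).1
  have hS1 : ∀ x ∈ box N L, ∑ i, ψ (x i) ≤ N * ε := fun x hx => by
    calc ∑ i, ψ (x i) ≤ ∑ _i : Fin N, ε := Finset.sum_le_sum fun i _ => (hψ1 _ (hx i)).2.1
      _ = N * ε := by simp
  have key := max_principle (N := N) (a := a) (b := b) (L := L)
    (fun t x => D t x - (∑ i, ψ (x i) + (ε + 2 * ε * (t - a))))
    (fun t x => lap (D t) x + r t x - 2 * ε) ?_ ?_ ?_ ?_ ?_ ?_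
  · intro t htt x hxx
    have := key t htt x hxx
    simp only at this
    have h1 := hS1 x hxx
    nlinarith [htt.2, mul_le_mul_of_nonneg_left htt.2 hε.le]
  · refine hc.sub (Continuous.continuousOn ?_)
    have := hS.continuous.comp (continuous_snd : Continuous (Prod.snd : ℝ × Eu N → Eu N))
    exact this.add (by fun_prop)
  · intro t htt
    exact (hx t htt).sub (hS.add contDiff_const)
  · intro t htt x
    have h1 : HasDerivAt (fun τ : ℝ => ∑ i, ψ (x i) + (ε + 2 * ε * (τ - a))) (2 * ε) t := by
      have := (((((hasDerivAt_id t).sub_const a).const_mul (2 * ε)).const_add ε).const_add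
        (∑ i, ψ (x i)))
      simpa using this
    exact (ht t htt x).sub h1
  · intro t htt x hxx
    have hcst : lap (fun _ : Eu N => ε + 2 * ε * (t - a)) x = 0 := by
      unfold lap
      refine Finset.sum_eq_zero fun i _ => ?_
      rw [iteratedFDeriv_const_of_ne (by norm_num)]
      simp
    rw [lap_sub (hx t htt) (hS.add contDiff_const), lap_add hS contDiff_const, lap_sum_coord hψ,
      hcst]
    have := hr t htt x hxx
    rw [Finset.sum_neg_distrib] at this
    linarith
  · intro x hxx
    have h1 := hS0 x hxx
    have h2 := h0 x hxx
    simp only [sub_self, mul_zero, add_zero]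
    linarith
  · intro t htt x hxx hi
    have h1 := hS0 x hxx
    have h2 := hb t htt x hxx hi
    simp only
    nlinarith [mul_nonneg hε.le (sub_nonneg.2 htt.1)]

lemma sn_one {N : ℕ} (κ : ℝ) (x : Eu N) :
    sn κ (fun _ => 1) x = ∏ i, Real.cos (κ * x i) := by
  unfold sn
  refine Finset.prod_congr rfl fun i _ => ?_
  rw [Int.cast_one, one_mul, Real.sin_add_pi_div_two]

lemma exists_smooth_approx {N : ℕ} {a b L κ : ℝ} (hab : a < b) (hL : 0 < L)
    (hκ : κ * L = Real.pi / 2) (u f : ℝ → Eu N → ℝ)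
    (hu : ContinuousOn (fun q : ℝ × Eu N => u q.1 q.2) (Icc a b ×ˢ univ))
    (hf : ContinuousOn (fun q : ℝ × Eu N => f q.1 q.2) (Icc a b ×ˢ univ))
    (hx : ∀ t ∈ Ioc a b, ContDiff ℝ 2 (u t))
    (ht : ∀ t ∈ Ioc a b, ∀ x, HasDerivAt (fun τ => u τ x) (lap (u t) x + f t x) t)
    {ε₀ : ℝ} (hε₀ : 0 < ε₀) :
    ∃ V g : ℝ × Eu N → ℝ, ContDiff ℝ 2 V ∧ Continuous g ∧
      (∀ t x, HasDerivAt (fun τ => V (τ, x)) (lap (fun y => V (t, y)) x + g (t, x)) t) ∧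
      (∀ t ∈ Icc a b, ∀ x ∈ box N L, |u t x - V (t, x)| ≤ ε₀) ∧
      (∀ t ∈ Icc a b, ∀ x ∈ box N (L / 2), |f t x - g (t, x)| ≤ ε₀) := by
  have hκ0 : 0 < κ := by
    by_contra h
    push Not at h
    have := mul_nonpos_of_nonpos_of_nonneg h hL.le
    linarith [Real.pi_pos]
  set K : Set (ℝ × Eu N) := Icc a b ×ˢ box N L with hKdef
  have hK : IsCompact K := isCompact_Icc.prod (box_compact N L)
  have hKu : K ⊆ Icc a b ×ˢ univ := prod_mono_right (subset_univ _)
  set c : ℝ := 1 + 2 * (b - a) + N with hc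
  have hc1 : 1 ≤ c := by
    have : (0 : ℝ) ≤ N := Nat.cast_nonneg N
    rw [hc]; linarith
  set ε : ℝ := ε₀ / c with hεdef
  have hε : 0 < ε := by positivity
  have hεc : ε * c = ε₀ := by rw [hεdef]; field_simp
  have hεle : ε ≤ ε₀ := by rw [← hεc]; nlinarith
  obtain ⟨P, hPmem, hP⟩ := approx hL hκ (fun q : ℝ × Eu N => u q.1 q.2) (hu.mono hKu) hε
  have hPc : ContDiff ℝ 2 (P : ℝ × Eu N → ℝ) := adjoin_contDiff hPmem
  let gP : ℝ × Eu N → ℝ := fun q => fderiv ℝ P q (1, 0) - lap (fun y => P (q.1, y)) q.2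
  have hgP : Continuous gP :=
    ((hPc.continuous_fderiv (by norm_num)).clm_apply continuous_const).sub
      (lap_slice_continuous hPc)
  let g0 : ℝ × Eu N → ℝ := fun q => f q.1 q.2 - gP q
  have hg0 : ContinuousOn g0 K := (hf.mono hKu).sub hgP.continuousOn
  obtain ⟨M, hM⟩ := hK.exists_bound_of_continuousOn hg0
  obtain ⟨ψ, hψ, hψ1, δ, hδ0, hδ2, hδ⟩ := barrier hL hκ hε M
  -- the approximated right-hand side
  let m : Eu N → ℝ := fun x => ∏ i, (max δ (Real.cos (κ * x i)))⁻¹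
  have hmc : Continuous m := by
    refine continuous_finsetProd _ fun i _ => ?_
    refine Continuous.inv₀ (by fun_prop) fun x => ?_
    exact (lt_of_lt_of_le hδ0 (le_max_left _ _)).ne'
  let h : ℝ × Eu N → ℝ := fun q => Real.exp (-q.1) * g0 q * m q.2
  have hh : ContinuousOn h K := by
    refine (ContinuousOn.mul (by fun_prop) hg0).mul ?_
    exact (hmc.comp continuous_snd).continuousOn
  obtain ⟨Q, hQmem, hQ⟩ := approx hL hκ h hh (ε := ε * Real.exp (-b)) (by positivity)
  have hg1mem : (Q : ℝ × Eu N → ℝ) * bas κ 0 (fun _ => 1) ∈ Sp N κ :=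
    adjoin_mul_Sp hQmem _ (Submodule.subset_span ⟨(0, fun _ => 1), rfl⟩)
  set g1 : ℝ × Eu N → ℝ := (Q : ℝ × Eu N → ℝ) * bas κ 0 (fun _ => 1) with hg1
  have hg1v : ∀ q, g1 q = Q q * (Real.exp q.1 * ∏ i, Real.cos (κ * q.2 i)) := by
    intro q
    simp only [hg1, Pi.mul_apply, bas, sn_one]
    simp
  have hg1c : Continuous g1 := by
    have : g1 = fun q => Q q * (Real.exp q.1 * ∏ i, Real.cos (κ * q.2 i)) := funext hg1v
    rw [this]
    fun_prop
  obtain ⟨v, hv, hvt, hva, hvb⟩ := solvable_Sp (a := a) hκ hg1mem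
  -- key error estimate
  have hcos0 : ∀ x ∈ box N L, ∀ i, 0 ≤ Real.cos (κ * x i) := by
    intro x hx i
    have h5 := abs_le.1 (hx i)
    apply Real.cos_nonneg_of_mem_Icc
    rw [← hκ]
    constructor <;> nlinarith [h5.1, h5.2]
  have hA : ∀ q ∈ K, |g0 q * ∏ i, (Real.cos (κ * q.2 i) * (max δ (Real.cos (κ * q.2 i)))⁻¹) - g1 q|
      ≤ ε := by
    intro q hq
    have e1 : g0 q * ∏ i, (Real.cos (κ * q.2 i) * (max δ (Real.cos (κ * q.2 i)))⁻¹) - g1 q =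
        (h q - Q q) * (Real.exp q.1 * ∏ i, Real.cos (κ * q.2 i)) := by
      rw [hg1v, Finset.prod_mul_distrib]
      simp only [h, m]
      have : Real.exp (-q.1) * Real.exp q.1 = 1 := by rw [← Real.exp_add]; simp
      linear_combination (-(g0 q * (∏ i, Real.cos (κ * q.2 i)) *
        ∏ i, (max δ (Real.cos (κ * q.2 i)))⁻¹)) * this
    rw [e1, abs_mul]
    have e2 : |h q - Q q| ≤ ε * Real.exp (-b) := by rw [abs_sub_comm]; exact hQ q hq
    have e3 : |Real.exp q.1 * ∏ i, Real.cos (κ * q.2 i)| ≤ Real.exp b := by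
      rw [abs_mul, Real.abs_exp, Finset.abs_prod]
      have e4 : ∏ i, |Real.cos (κ * q.2 i)| ≤ 1 :=
        Finset.prod_le_one (fun i _ => abs_nonneg _) fun i _ => Real.abs_cos_le_one _
      calc Real.exp q.1 * ∏ i, |Real.cos (κ * q.2 i)| ≤ Real.exp q.1 * 1 := by gcongr
        _ ≤ Real.exp b := by rw [mul_one]; exact Real.exp_le_exp.2 hq.1.2
    calc |h q - Q q| * |Real.exp q.1 * ∏ i, Real.cos (κ * q.2 i)|
        ≤ (ε * Real.exp (-b)) * Real.exp b := by gcongr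
      _ = ε := by rw [mul_assoc, ← Real.exp_add]; simp
  have hB : ∀ q ∈ K, (∀ i, δ ≤ Real.cos (κ * q.2 i)) → |g0 q - g1 q| ≤ ε := by
    intro q hq hi
    have := hA q hq
    have e1 : ∏ i, (Real.cos (κ * q.2 i) * (max δ (Real.cos (κ * q.2 i)))⁻¹) = 1 := by
      refine Finset.prod_eq_one fun i _ => ?_
      rw [max_eq_right (hi i)]
      exact mul_inv_cancel₀ (lt_of_lt_of_le hδ0 (hi i)).ne'
    rwa [e1, mul_one] at this
  have hC : ∀ q ∈ K, |g0 q - g1 q| ≤ ε + ∑ i, -deriv (deriv ψ) (q.2 i) := by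
    intro q hq
    have hnn : ∀ i ∈ Finset.univ, 0 ≤ -deriv (deriv ψ) (q.2 i) := fun i _ => by
      have := (hψ1 _ (hq.2 i)).2.2
      linarith
    by_cases hi : ∀ i, δ ≤ Real.cos (κ * q.2 i)
    · linarith [hB q hq hi, Finset.sum_nonneg hnn]
    · push Not at hi
      obtain ⟨i, hi⟩ := hi
      have e1 := hδ _ (hq.2 i) hi
      have e2 := Finset.single_le_sum hnn (Finset.mem_univ i)
      set χ := ∏ i, (Real.cos (κ * q.2 i) * (max δ (Real.cos (κ * q.2 i)))⁻¹) with hχ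
      have f0 : ∀ i ∈ Finset.univ, 0 ≤ Real.cos (κ * q.2 i) * (max δ (Real.cos (κ * q.2 i)))⁻¹ :=
        fun i _ => mul_nonneg (hcos0 _ hq.2 i)
          (inv_nonneg.2 (hδ0.le.trans (le_max_left _ _)))
      have f1 : ∀ i ∈ Finset.univ, Real.cos (κ * q.2 i) * (max δ (Real.cos (κ * q.2 i)))⁻¹ ≤ 1 :=
        fun i _ => by
          rw [← div_eq_mul_inv]
          exact div_le_one_of_le₀ (le_max_right _ _) (hδ0.le.trans (le_max_left _ _))
      have hχ0 : 0 ≤ χ := Finset.prod_nonneg f0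
      have hχ1 : χ ≤ 1 := Finset.prod_le_one f0 f1
      have e3 : |g0 q * (1 - χ)| ≤ M := by
        rw [abs_mul]
        have := hM q hq
        rw [Real.norm_eq_abs] at this
        have e4 : |1 - χ| ≤ 1 := by rw [abs_le]; constructor <;> linarith
        calc |g0 q| * |1 - χ| ≤ |g0 q| * 1 := by gcongr
          _ ≤ M := by linarith
      have e5 := hA q hq
      calc |g0 q - g1 q| = |g0 q * (1 - χ) + (g0 q * χ - g1 q)| := by congr 1; ring
        _ ≤ |g0 q * (1 - χ)| + |g0 q * χ - g1 q| := abs_add_le _ _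
        _ ≤ _ := by linarith
  have hVt : ∀ t x, HasDerivAt (fun τ => P (τ, x) + v (τ, x))
      (lap (fun y => P (t, y) + v (t, y)) x + (gP (t, x) + g1 (t, x))) t := by
    intro t x
    have d1 := time_deriv (hPc.differentiable (by norm_num)) t x
    refine HasDerivAt.congr_deriv (d1.add (hvt t x)) ?_
    rw [lap_add (slice_contDiff hPc t) (slice_contDiff hv t)]
    simp only [gP]
    ring
  have hVc : ContDiff ℝ 2 fun q => P q + v q := hPc.add hv
  have hVs : ∀ t, ContDiff ℝ 2 fun y => P (t, y) + v (t, y) := fun t => slice_contDiff hVc t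
  refine ⟨fun q => P q + v q, fun q => gP q + g1 q, hVc, hgP.add hg1c, hVt, ?_, ?_⟩
  · have hPu : ∀ t ∈ Icc a b, ∀ x ∈ box N L, |u t x - P (t, x)| ≤ ε := fun t htt x hxx => by
      rw [abs_sub_comm]; exact hP (t, x) ⟨htt, hxx⟩
    have hcD : ContinuousOn (fun q : ℝ × Eu N => u q.1 q.2 - (P (q.1, q.2) + v (q.1, q.2))) K :=
      (hu.mono hKu).sub hVc.continuous.continuousOn
    have haa : a ∈ Icc a b := ⟨le_refl _, hab.le⟩
    have up := compare (N := N) (a := a) (b := b) (L := L) hε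
      (fun t x => u t x - (P (t, x) + v (t, x))) (fun t x => g0 (t, x) - g1 (t, x)) ψ hψ hψ1 hcD
      (fun t htt => (hx t htt).sub (hVs t))
      (fun t htt x => by
        refine HasDerivAt.congr_deriv ((ht t htt x).sub (hVt t x)) ?_
        rw [lap_sub (hx t htt) (hVs t)]
        simp only [g0]
        ring)
      (fun t htt x hxx => (le_abs_self _).trans (hC (t, x) ⟨⟨htt.1.le, htt.2⟩, hxx⟩))
      (fun x hxx => by
        simp only [hva, add_zero]
        exact (abs_le.1 (hPu a haa x hxx)).2)
      (fun t htt x hxx hi => by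
        simp only [hvb t x hi, add_zero]
        exact (abs_le.1 (hPu t htt x hxx)).2)
    have dn := compare (N := N) (a := a) (b := b) (L := L) hε
      (fun t x => (P (t, x) + v (t, x)) - u t x) (fun t x => g1 (t, x) - g0 (t, x)) ψ hψ hψ1
      (by
        have := hcD.neg
        refine this.congr fun q _ => ?_
        simp only [Pi.neg_apply]
        ring)
      (fun t htt => (hVs t).sub (hx t htt))
      (fun t htt x => by
        refine HasDerivAt.congr_deriv ((hVt t x).sub (ht t htt x)) ?_
        rw [lap_sub (hVs t) (hx t htt)]
        simp only [g0]
        ring)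
      (fun t htt x hxx => by
        have := hC (t, x) ⟨⟨htt.1.le, htt.2⟩, hxx⟩
        rw [abs_sub_comm] at this
        exact (le_abs_self _).trans this)
      (fun x hxx => by
        simp only [hva, add_zero]
        linarith [(abs_le.1 (hPu a haa x hxx)).1])
      (fun t htt x hxx hi => by
        simp only [hvb t x hi, add_zero]
        linarith [(abs_le.1 (hPu t htt x hxx)).1])
    intro t htt x hxx
    have h1 := up t htt x hxx
    have h2 := dn t htt x hxx
    rw [← hc, hεc] at h1 h2
    rw [abs_le]
    constructor <;> linarith
  · intro t htt x hxx
    have hxx' : x ∈ box N L := fun i => (hxx i).trans (by linarith)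
    have h1 := hB (t, x) ⟨htt, hxx'⟩ ?_
    · refine le_trans (le_of_eq ?_) (h1.trans hεle)
      congr 1
      simp only [g0]
      ring
    · intro i
      refine hδ2.trans ?_
      have h5 := abs_le.1 (hxx i)
      rw [← Real.cos_pi_div_three, ← Real.cos_abs (κ * x i)]
      apply Real.cos_le_cos_of_nonneg_of_le_pi (abs_nonneg _) (by linarith [Real.pi_pos])
      rw [abs_le]
      constructor <;> nlinarith [h5.1, h5.2, Real.pi_pos]

lemma dd_tsupport {N : ℕ} (i : Fin N) (f : Eu N → ℝ) : tsupport (dd i f) ⊆ tsupport f :=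
  tsupport_fderiv_apply_subset ℝ _

lemma lap_zero_of_notMem {N : ℕ} {f : Eu N → ℝ} (hf : ContDiff ℝ 2 f) {x : Eu N}
    (hx : x ∉ tsupport f) : lap f x = 0 := by
  rw [lap_eq_dd hf]
  refine Finset.sum_eq_zero fun i _ => ?_
  exact image_eq_zero_of_notMem_tsupport fun h => hx (dd_tsupport i f (dd_tsupport i _ h))

lemma integrable_mul_cs {N : ℕ} {f φ : Eu N → ℝ} (hf : Continuous f) (hφ : Continuous φ)
    (hs : HasCompactSupport φ) : Integrable (fun x => f x * φ x) :=
  (hf.mul hφ).integrable_of_hasCompactSupport hs.mul_left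

lemma green {N : ℕ} {V Ξ : Eu N → ℝ} (hV : ContDiff ℝ 2 V) (hΞ : ContDiff ℝ 2 Ξ)
    (hs : HasCompactSupport Ξ) :
    ∫ x, lap V x * Ξ x = ∫ x, V x * lap Ξ x := by
  have hs1 : ∀ i, HasCompactSupport (dd i Ξ) := fun i => hs.mono' (subset_tsupport _ |>.trans (dd_tsupport i Ξ))
  have hs2 : ∀ i, HasCompactSupport (dd i (dd i Ξ)) :=
    fun i => (hs1 i).mono' (subset_tsupport _ |>.trans (dd_tsupport i _))
  have c1 : ∀ (i : Fin N) {f : Eu N → ℝ}, ContDiff ℝ 2 f → ContDiff ℝ 1 (dd i f) :=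
    fun i f hf => dd_contDiff i hf (by norm_num)
  have c2 : ∀ (i : Fin N) {f : Eu N → ℝ}, ContDiff ℝ 2 f → Continuous (dd i (dd i f)) :=
    fun i f hf => (dd_contDiff (n := 0) i (c1 i hf) (by norm_num)).continuous
  have key : ∀ i, ∫ x, dd i (dd i V) x * Ξ x = ∫ x, V x * dd i (dd i Ξ) x := by
    intro i
    have e1 : ∫ x, V x * dd i (dd i Ξ) x = - ∫ x, dd i V x * dd i Ξ x :=
      integral_mul_fderiv_eq_neg_fderiv_mul_of_integrable
        (integrable_mul_cs (c1 i hV).continuous (c1 i hΞ).continuous (hs1 i))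
        (integrable_mul_cs hV.continuous (c2 i hΞ) (hs2 i))
        (integrable_mul_cs hV.continuous (c1 i hΞ).continuous (hs1 i))
        (fun x _ => (hV.differentiable (by norm_num)).differentiableAt)
        (fun x _ => ((c1 i hΞ).differentiable (by norm_num)).differentiableAt)
    have e2 : ∫ x, dd i V x * dd i Ξ x = - ∫ x, dd i (dd i V) x * Ξ x :=
      integral_mul_fderiv_eq_neg_fderiv_mul_of_integrable
        (integrable_mul_cs (c2 i hV) hΞ.continuous hs)
        (integrable_mul_cs (c1 i hV).continuous (c1 i hΞ).continuous (hs1 i))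
        (integrable_mul_cs (c1 i hV).continuous hΞ.continuous hs)
        (fun x _ => ((c1 i hV).differentiable (by norm_num)).differentiableAt)
        (fun x _ => (hΞ.differentiable (by norm_num)).differentiableAt)
    rw [e1, e2, neg_neg]
  simp_rw [lap_eq_dd hV, lap_eq_dd hΞ, Finset.sum_mul, Finset.mul_sum]
  rw [integral_finsetSum _ fun i _ => integrable_mul_cs (c2 i hV) hΞ.continuous hs,
    integral_finsetSum _ fun i _ => integrable_mul_cs hV.continuous (c2 i hΞ) (hs2 i)]
  exact Finset.sum_congr rfl fun i _ => key i

lemma param_deriv {N : ℕ} {H H' : ℝ → Eu N → ℝ} {K : Set (Eu N)} (hK : IsCompact K)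
    (hH : ∀ t, Continuous (H t)) (hH' : Continuous (fun q : ℝ × Eu N => H' q.1 q.2))
    (h0 : ∀ t, ∀ x ∉ K, H t x = 0) (h0' : ∀ t, ∀ x ∉ K, H' t x = 0)
    (hd : ∀ t x, HasDerivAt (fun τ => H τ x) (H' t x) t) (t : ℝ) :
    HasDerivAt (fun τ => ∫ x, H τ x) (∫ x, H' t x) t := by
  obtain ⟨M, hM⟩ := ((isCompact_Icc (a := t - 1) (b := t + 1)).prod hK).exists_bound_of_continuousOn
    hH'.continuousOn
  refine (hasDerivAt_integral_of_dominated_loc_of_deriv_le (s := Icc (t-1) (t+1))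
    (bound := K.indicator fun _ => M) (F := H) (F' := H') (μ := volume)
    (Icc_mem_nhds (by linarith) (by linarith)) ?_ ?_ ?_ ?_ ?_ ?_).2
  · exact Eventually.of_forall fun τ => (hH τ).aestronglyMeasurable
  · exact (hH t).integrable_of_hasCompactSupport (HasCompactSupport.intro hK (h0 t))
  · exact (hH'.comp (by fun_prop : Continuous fun x : Eu N => (t, x))).aestronglyMeasurable
  · refine Eventually.of_forall fun x τ hτ => ?_
    by_cases hxK : x ∈ K
    · rw [indicator_of_mem hxK]; exact hM (τ, x) ⟨hτ, hxK⟩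
    · rw [indicator_of_notMem hxK, h0' τ x hxK, norm_zero]
  · exact (integrable_indicator_iff hK.measurableSet).2 (integrableOn_const hK.measure_ne_top)
  · exact Eventually.of_forall fun x τ _ => hd τ x

lemma param_cont {N : ℕ} {a b : ℝ} {h : ℝ → Eu N → ℝ} {φ : Eu N → ℝ}
    (hh : ContinuousOn (fun q : ℝ × Eu N => h q.1 q.2) (Icc a b ×ˢ univ))
    (hφ : Continuous φ) (hs : HasCompactSupport φ) :
    ContinuousOn (fun t => ∫ x, h t x * φ x) (Icc a b) := by
  refine continuousOn_integral_of_compact_support (k := tsupport φ) hs ?_ ?_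
  · exact hh.mul (hφ.comp continuous_snd).continuousOn
  · intro t x _ hx
    rw [image_eq_zero_of_notMem_tsupport hx, mul_zero]

lemma slice_cont {N : ℕ} {s : Set ℝ} {h : ℝ → Eu N → ℝ}
    (hh : ContinuousOn (fun q : ℝ × Eu N => h q.1 q.2) (s ×ˢ univ)) {t : ℝ} (ht : t ∈ s) :
    Continuous (h t) :=
  hh.comp_continuous (f := fun x : Eu N => (t, x)) (by fun_prop) fun x => ⟨ht, mem_univ _⟩

lemma int_diff_le {N : ℕ} {f g φ : Eu N → ℝ} {ε : ℝ} (hf : Continuous f) (hg : Continuous g)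
    (hφ : Continuous φ) (hs : HasCompactSupport φ) {K : Set (Eu N)}
    (hK : ∀ x ∉ K, φ x = 0) (h : ∀ x ∈ K, |f x - g x| ≤ ε) :
    |(∫ x, f x * φ x) - ∫ x, g x * φ x| ≤ ε * ∫ x, |φ x| := by
  rw [← integral_sub (integrable_mul_cs hf hφ hs) (integrable_mul_cs hg hφ hs),
    ← integral_const_mul]
  refine norm_integral_le_of_norm_le (f := fun x => f x * φ x - g x * φ x) ?_ ?_
  · exact ((hφ.integrable_of_hasCompactSupport hs).abs).const_mul ε
  · refine Eventually.of_forall fun x => ?_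
    rw [← sub_mul, norm_mul, Real.norm_eq_abs, Real.norm_eq_abs]
    by_cases hx : x ∈ K
    · exact mul_le_mul_of_nonneg_right (h x hx) (abs_nonneg _)
    · rw [hK x hx]; simp

lemma weak_form {N : ℕ} {a b L : ℝ} (hab : a < b) (hL : 0 < L)
    (u f : ℝ → Eu N → ℝ)
    (hu : ContinuousOn (fun q : ℝ × Eu N => u q.1 q.2) (Icc a b ×ˢ univ))
    (hf : ContinuousOn (fun q : ℝ × Eu N => f q.1 q.2) (Icc a b ×ˢ univ))
    (hx : ∀ t ∈ Ioc a b, ContDiff ℝ 2 (u t))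
    (ht : ∀ t ∈ Ioc a b, ∀ x, HasDerivAt (fun τ => u τ x) (lap (u t) x + f t x) t)
    {Ξ : Eu N → ℝ} (hΞ : ContDiff ℝ 2 Ξ) (hs : HasCompactSupport Ξ)
    (hbox : tsupport Ξ ⊆ box N (L / 2)) :
    (∫ x, u b x * Ξ x) - ∫ x, u a x * Ξ x =
      ∫ t in a..b, ((∫ x, u t x * lap Ξ x) + ∫ x, f t x * Ξ x) := by
  have hlc : Continuous (lap Ξ) := lap_continuous hΞ
  have hls : HasCompactSupport (lap Ξ) :=
    HasCompactSupport.intro hs fun x hx => lap_zero_of_notMem hΞ hx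
  have hΞ0 : ∀ x ∉ box N (L / 2), Ξ x = 0 := fun x hx =>
    image_eq_zero_of_notMem_tsupport fun h => hx (hbox h)
  have hl0 : ∀ x ∉ box N (L / 2), lap Ξ x = 0 := fun x hx =>
    lap_zero_of_notMem hΞ fun h => hx (hbox h)
  set A := ∫ x, |Ξ x| with hA
  set B := ∫ x, |lap Ξ x| with hB
  have hA0 : 0 ≤ A := integral_nonneg fun x => abs_nonneg _
  have hB0 : 0 ≤ B := integral_nonneg fun x => abs_nonneg _
  have hΦc : ContinuousOn (fun t => (∫ x, u t x * lap Ξ x) + ∫ x, f t x * Ξ x) (Icc a b) :=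
    (param_cont hu hlc hls).add (param_cont hf hΞ.continuous hs)
  have main : ∀ ε > 0, |((∫ x, u b x * Ξ x) - ∫ x, u a x * Ξ x) -
      ∫ t in a..b, ((∫ x, u t x * lap Ξ x) + ∫ x, f t x * Ξ x)| ≤
      ε * (2 * A + (A + B) * (b - a)) := by
    intro ε hε
    obtain ⟨V, g, hV, hg, hVt, huV, hfg⟩ := exists_smooth_approx (κ := Real.pi / 2 / L) hab hL
      (by field_simp) u f hu hf hx ht hε
    have huV' : ∀ t ∈ Icc a b, ∀ x ∈ box N (L/2), |u t x - V (t, x)| ≤ ε := fun t h x hx =>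
      huV t h x fun i => (hx i).trans (by linarith)
    have hVc : ∀ t, Continuous fun x => V (t, x) := fun t => (slice_contDiff hV t).continuous
    have hgc : ∀ t, Continuous fun x => g (t, x) := fun t => hg.comp (by fun_prop)
    -- derivative of the smooth functional
    have hFd : ∀ t, HasDerivAt (fun τ => ∫ x, V (τ, x) * Ξ x)
        ((∫ x, V (t, x) * lap Ξ x) + ∫ x, g (t, x) * Ξ x) t := by
      intro t
      have h1 := param_deriv (H := fun τ x => V (τ, x) * Ξ x)
        (H' := fun τ x => (lap (fun y => V (τ, y)) x + g (τ, x)) * Ξ x) (K := tsupport Ξ) hs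
        (fun τ => (hVc τ).mul hΞ.continuous)
        (((lap_slice_continuous hV).add hg).mul (hΞ.continuous.comp continuous_snd))
        (fun τ x hx => by simp [image_eq_zero_of_notMem_tsupport hx])
        (fun τ x hx => by simp [image_eq_zero_of_notMem_tsupport hx])
        (fun τ x => (hVt τ x).mul_const _) t
      refine h1.congr_deriv ?_
      rw [← green (slice_contDiff hV t) hΞ hs, ← integral_add]
      · exact integral_congr_ae (Eventually.of_forall fun x => by simp only []; ring)
      · exact integrable_mul_cs (lap_continuous (slice_contDiff hV t)) hΞ.continuous hs
      · exact integrable_mul_cs (hgc t) hΞ.continuous hs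
    have hΨc : ContinuousOn (fun t => (∫ x, V (t, x) * lap Ξ x) + ∫ x, g (t, x) * Ξ x)
        (Icc a b) :=
      (param_cont (h := fun t x => V (t, x)) hV.continuous.continuousOn hlc hls).add
        (param_cont (h := fun t x => g (t, x)) hg.continuousOn hΞ.continuous hs)
    have hi1 := hΦc.intervalIntegrable_of_Icc (μ := volume) hab.le
    have hi2 := hΨc.intervalIntegrable_of_Icc (μ := volume) hab.le
    have hFTC := intervalIntegral.integral_eq_sub_of_hasDerivAt (fun t _ => hFd t) hi2
    have hdb : ∀ t ∈ Icc a b, |((∫ x, u t x * Ξ x)) - ∫ x, V (t, x) * Ξ x| ≤ ε * A :=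
      fun t h => int_diff_le (slice_cont hu h) (hVc t) hΞ.continuous hs hΞ0 (huV' t h)
    have h1 := hdb b ⟨hab.le, le_rfl⟩
    have h2 := hdb a ⟨le_rfl, hab.le⟩
    have h3 : |(∫ t in a..b, ((∫ x, u t x * lap Ξ x) + ∫ x, f t x * Ξ x)) -
        ∫ t in a..b, ((∫ x, V (t, x) * lap Ξ x) + ∫ x, g (t, x) * Ξ x)| ≤
        (ε * (A + B)) * |b - a| := by
      rw [← intervalIntegral.integral_sub hi1 hi2, ← Real.norm_eq_abs]
      refine intervalIntegral.norm_integral_le_of_norm_le_const fun t h => ?_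
      rw [uIoc_of_le hab.le] at h
      have h' : t ∈ Icc a b := ⟨h.1.le, h.2⟩
      have k1 := int_diff_le (slice_cont hu h') (hVc t) hlc hls hl0 (huV' t h')
      have k2 := int_diff_le (slice_cont hf h') (hgc t) hΞ.continuous hs hΞ0 (hfg t h')
      rw [Real.norm_eq_abs]
      rw [abs_le] at k1 k2 ⊢
      constructor <;> linarith
    rw [abs_of_pos (by linarith : 0 < b - a)] at h3
    rw [hFTC] at h3
    rw [abs_le] at h1 h2 h3 ⊢
    constructor <;> linarith
  rw [← sub_eq_zero, ← abs_nonpos_iff]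
  refine le_of_forall_pos_le_add fun δ hδ => ?_
  have hD : 0 < 2 * A + (A + B) * (b - a) + 1 := by
    have := mul_nonneg (add_nonneg hA0 hB0) (sub_nonneg.2 hab.le)
    linarith
  refine (main (δ / (2 * A + (A + B) * (b - a) + 1)) (by positivity)).trans ?_
  rw [zero_add, div_mul_eq_mul_div, div_le_iff₀ hD]
  nlinarith

lemma dd_scale {N : ℕ} (i : Fin N) {φ : Eu N → ℝ} (hφ : Differentiable ℝ φ) (r : ℝ) :
    dd i (fun y => φ (r • y)) = fun y => r * dd i φ (r • y) := by
  funext x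
  have h1 : HasFDerivAt (fun y : Eu N => r • y) (r • ContinuousLinearMap.id ℝ (Eu N)) x :=
    (hasFDerivAt_id x).const_smul r
  have h2 := (hφ (r • x)).hasFDerivAt.comp x h1
  unfold dd
  have h3 : fderiv ℝ (fun y => φ (r • y)) x = _ := h2.fderiv
  rw [h3]
  simp

lemma dd_const_mul {N : ℕ} (i : Fin N) {φ : Eu N → ℝ} (hφ : Differentiable ℝ φ) (r : ℝ) :
    dd i (fun y => r * φ y) = fun y => r * dd i φ y := by
  funext x
  unfold dd
  rw [((hφ x).hasFDerivAt.const_mul r).fderiv]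
  simp

lemma dd_mul {N : ℕ} (i : Fin N) {φ ψ : Eu N → ℝ} (hφ : Differentiable ℝ φ)
    (hψ : Differentiable ℝ ψ) :
    dd i (fun y => φ y * ψ y) = fun y => φ y * dd i ψ y + ψ y * dd i φ y := by
  funext x
  unfold dd
  have h3 : fderiv ℝ (fun y => φ y * ψ y) x = _ :=
    ((hφ x).hasFDerivAt.mul (hψ x).hasFDerivAt).fderiv
  rw [h3]
  simp

lemma dd_pow {N : ℕ} (i : Fin N) {φ : Eu N → ℝ} (hφ : Differentiable ℝ φ) (n : ℕ) :
    dd i (fun y => φ y ^ (n + 1)) = fun y => (n + 1 : ℝ) * (φ y ^ n * dd i φ y) := by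
  funext x
  unfold dd
  rw [((hφ x).hasFDerivAt.pow (n + 1)).fderiv]
  simp [mul_assoc]

lemma lap_scale {N : ℕ} {φ : Eu N → ℝ} (hφ : ContDiff ℝ 2 φ) (r : ℝ) (x : Eu N) :
    lap (fun y => φ (r • y)) x = r ^ 2 * lap φ (r • x) := by
  have hc : ContDiff ℝ 2 (fun y => φ (r • y)) := hφ.comp (contDiff_const_smul r)
  rw [lap_eq_dd hc, lap_eq_dd hφ, Finset.mul_sum]
  refine Finset.sum_congr rfl fun i _ => ?_
  have h1 : Differentiable ℝ (dd i φ) :=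
    (dd_contDiff (n := 1) i hφ (by norm_num)).differentiable (by norm_num)
  rw [dd_scale i (hφ.differentiable (by norm_num)),
    dd_const_mul i (φ := fun y => dd i φ (r • y)) (h1.comp (differentiable_id.const_smul r)),
    dd_scale i h1]
  ring

lemma lap_pow_bound {N : ℕ} {ξ : Eu N → ℝ} (hξ : ContDiff ℝ 2 ξ) (hs : HasCompactSupport ξ)
    (h0 : ∀ x, 0 ≤ ξ x) (h1 : ∀ x, ξ x ≤ 1) (k : ℕ) :
    ∃ C : ℝ, 0 ≤ C ∧ ∀ x, |lap (fun y => ξ y ^ (k + 2)) x| ≤ C * ξ x ^ k := by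
  have d0 : Differentiable ℝ ξ := hξ.differentiable (by norm_num)
  have c1 : ∀ i, ContDiff ℝ 1 (dd i ξ) := fun i => dd_contDiff i hξ (by norm_num)
  have d1 : ∀ i, Differentiable ℝ (dd i ξ) := fun i => (c1 i).differentiable (by norm_num)
  have hs1 : ∀ i, HasCompactSupport (dd i ξ) := fun i =>
    hs.mono' (subset_tsupport _ |>.trans (dd_tsupport i ξ))
  have hs2 : ∀ i, HasCompactSupport (dd i (dd i ξ)) :=
    fun i => (hs1 i).mono' (subset_tsupport _ |>.trans (dd_tsupport i _))
  have b1 : ∀ i, ∃ M, ∀ x, ‖dd i ξ x‖ ≤ M := fun i =>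
    (hs1 i).exists_bound_of_continuous (c1 i).continuous
  have b2 : ∀ i, ∃ M, ∀ x, ‖dd i (dd i ξ) x‖ ≤ M := fun i =>
    (hs2 i).exists_bound_of_continuous
      (dd_contDiff (n := 0) i (c1 i) (by norm_num)).continuous
  choose M hM using b1
  choose M' hM' using b2
  have hM0 : ∀ i, 0 ≤ M i := fun i => (norm_nonneg _).trans (hM i 0)
  have hM0' : ∀ i, 0 ≤ M' i := fun i => (norm_nonneg _).trans (hM' i 0)
  refine ⟨∑ i, (k + 2 : ℝ) * ((k + 1 : ℝ) * M i ^ 2 + M' i), ?_, fun x => ?_⟩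
  · refine Finset.sum_nonneg fun i _ => ?_
    have := hM0' i
    positivity
  rw [lap_eq_dd (hξ.pow (k + 2)), Finset.sum_mul]
  refine (Finset.abs_sum_le_sum_abs _ _).trans (Finset.sum_le_sum fun i _ => ?_)
  have e : dd i (dd i (fun y => ξ y ^ (k + 2))) x = (k + 2 : ℝ) *
      (ξ x ^ (k + 1) * dd i (dd i ξ) x + dd i ξ x * ((k + 1 : ℝ) * (ξ x ^ k * dd i ξ x))) := by
    have e1 := dd_pow i d0 (k + 1)
    rw [e1, dd_const_mul i (φ := fun y => ξ y ^ (k + 1) * dd i ξ y) ((d0.pow (k + 1)).mul (d1 i)),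
      dd_mul i (φ := fun y => ξ y ^ (k + 1)) (d0.pow (k + 1)) (d1 i), dd_pow i d0 k]
    push_cast
    ring
  rw [e, abs_mul, abs_of_nonneg (by positivity : (0:ℝ) ≤ (k:ℝ) + 2), mul_assoc]
  refine mul_le_mul_of_nonneg_left ?_ (by positivity)
  refine (abs_add_le _ _).trans ?_
  have hk := pow_nonneg (h0 x) k
  have hk1 := pow_nonneg (h0 x) (k + 1)
  have t1 : |ξ x ^ (k + 1) * dd i (dd i ξ) x| ≤ M' i * ξ x ^ k := by
    rw [abs_mul, abs_of_nonneg hk1, mul_comm]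
    have := hM' i x
    rw [Real.norm_eq_abs] at this
    refine mul_le_mul this ?_ hk1 (hM0' i)
    exact pow_le_pow_of_le_one (h0 x) (h1 x) (by omega)
  have t2 : |dd i ξ x * ((k + 1 : ℝ) * (ξ x ^ k * dd i ξ x))| ≤ (k + 1) * M i ^ 2 * ξ x ^ k := by
    have e2 : dd i ξ x * ((k + 1 : ℝ) * (ξ x ^ k * dd i ξ x)) =
      (k + 1 : ℝ) * dd i ξ x ^ 2 * ξ x ^ k := by ring
    rw [e2, abs_of_nonneg (by positivity)]
    have h := hM i x
    rw [Real.norm_eq_abs] at h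
    have : dd i ξ x ^ 2 ≤ M i ^ 2 := sq_le_sq' (by have := abs_le.1 h; linarith) (abs_le.1 h).2
    gcongr
  linarith

lemma exists_test (N k : ℕ) : ∃ ξ : Eu N → ℝ, ∃ C : ℝ, 0 ≤ C ∧ ContDiff ℝ 2 ξ ∧
    (∀ x, 0 ≤ ξ x) ∧ (∀ x, ξ x ≤ 1) ∧ (∀ x, ‖x‖ ≤ 1 → ξ x = 1) ∧ (∀ x, 2 ≤ ‖x‖ → ξ x = 0) ∧
    ∀ R : ℝ, ∀ x, |lap (fun y => ξ (R⁻¹ • y) ^ (k + 2)) x| ≤ C * R⁻¹ ^ 2 * ξ (R⁻¹ • x) ^ k := by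
  let ξ : ContDiffBump (0 : Eu N) := ⟨1, 2, by norm_num, by norm_num⟩
  have hξ : ContDiff ℝ 2 ξ := ξ.contDiff
  obtain ⟨C, hC, hb⟩ := lap_pow_bound hξ ξ.hasCompactSupport (fun _ => ξ.nonneg)
    (fun _ => ξ.le_one) k
  refine ⟨ξ, C, hC, hξ, fun _ => ξ.nonneg, fun _ => ξ.le_one, fun x hx => ?_, fun x hx => ?_,
    fun R x => ?_⟩
  · exact ξ.one_of_mem_closedBall (by simpa using hx)
  · exact ξ.zero_of_le_dist (by simpa using hx)
  · rw [lap_scale (φ := fun y => ξ y ^ (k + 2)) (hξ.pow _), abs_mul,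
      abs_of_nonneg (sq_nonneg _)]
    have := mul_le_mul_of_nonneg_left (hb (R⁻¹ • x)) (sq_nonneg R⁻¹)
    linarith

lemma young_simple {p x y : ℝ} (hp : 1 < p) (hx : 0 ≤ x) (hy : 0 ≤ y) :
    x * y ≤ x ^ p + y ^ (p / (p - 1)) := by
  have hpq : p.HolderConjugate (p / (p - 1)) := Real.HolderConjugate.conjExponent hp
  refine (Real.young_inequality_of_nonneg hx hy hpq).trans ?_
  have h1 : x ^ p / p ≤ x ^ p := div_le_self (by positivity) hp.le
  have h2 : y ^ (p / (p - 1)) / (p / (p - 1)) ≤ y ^ (p / (p - 1)) :=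
    div_le_self (by positivity) hpq.symm.lt.le
  linarith

lemma young_test {p U A μ : ℝ} {k : ℕ} (hp : 1 < p) (hk : 2 ≤ k * (p - 1)) (hU : 0 ≤ U)
    (hA : 0 ≤ A) (h0 : 0 ≤ μ) (h1 : μ ≤ 1) :
    U * A * μ ^ k ≤ U ^ p * μ ^ (k + 2) + A ^ (p / (p - 1)) := by
  have hp0 : 0 < p := by linarith
  have e1 : μ ^ k ≤ μ ^ (((k + 2 : ℕ) : ℝ) / p) := by
    rw [← Real.rpow_natCast]
    refine Real.rpow_le_rpow_of_exponent_ge_of_imp h0 h1 ?_ ?_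
    · rw [div_le_iff₀ hp0]; push_cast; nlinarith
    · intro _ h
      rw [h] at hk
      norm_num at hk
  have e2 : (U * μ ^ (((k + 2 : ℕ) : ℝ) / p)) ^ p = U ^ p * μ ^ (k + 2) := by
    rw [Real.mul_rpow hU (by positivity), ← Real.rpow_mul h0, div_mul_cancel₀ _ hp0.ne',
      Real.rpow_natCast]
  rw [← e2]
  refine le_trans ?_ (young_simple hp (by positivity) hA)
  calc U * A * μ ^ k ≤ U * A * μ ^ (((k + 2 : ℕ) : ℝ) / p) := by gcongr
    _ = _ := by ring

/-- Pointwise estimate of the integrand. -/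
lemma pointwise {p v m m' d T B z l : ℝ} {k : ℕ} (hp : 1 < p) (hk : 2 ≤ k * (p - 1))
    (hT : 0 < T) (hm0 : 0 ≤ m) (hm1 : m ≤ 1) (hz0 : 0 ≤ z) (hz1 : z ≤ 1) (hB : 0 ≤ B)
    (hm' : |m'| ≤ 1 / T) (hl : |l| ≤ B * z ^ k) (hd : d = ((k + 2 : ℕ) : ℝ) * m ^ (k + 1) * m') :
    -(((k + 2 : ℝ) / T + B) ^ (p / (p - 1))) ≤
      d * (v * z ^ (k + 2)) + m ^ (k + 2) * (v * l) + m ^ (k + 2) * (|v| ^ p * z ^ (k + 2)) := by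
  have hy := young_test (A := (k + 2 : ℝ) / T + B) hp hk (abs_nonneg v) (by positivity)
    (mul_nonneg hm0 hz0) (mul_le_one₀ hm1 hz0 hz1)
  have a1 : |d * (v * z ^ (k + 2))| ≤ |v| * ((k + 2 : ℝ) / T) * (m * z) ^ k := by
    rw [hd, abs_mul, abs_mul, abs_mul, abs_mul, abs_of_nonneg (pow_nonneg hm0 _),
      abs_of_nonneg (pow_nonneg hz0 _), abs_of_nonneg (Nat.cast_nonneg _), mul_pow]
    have b1 : m ^ (k + 1) ≤ m ^ k := pow_le_pow_of_le_one hm0 hm1 (by omega)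
    have b2 : z ^ (k + 2) ≤ z ^ k := pow_le_pow_of_le_one hz0 hz1 (by omega)
    calc ((k + 2 : ℕ) : ℝ) * m ^ (k + 1) * |m'| * (|v| * z ^ (k + 2))
        ≤ ((k + 2 : ℕ) : ℝ) * m ^ k * (1 / T) * (|v| * z ^ k) := by gcongr
      _ = _ := by push_cast; ring
  have a2 : |m ^ (k + 2) * (v * l)| ≤ |v| * B * (m * z) ^ k := by
    rw [abs_mul, abs_mul, abs_of_nonneg (pow_nonneg hm0 _), mul_pow]
    have b1 : m ^ (k + 2) ≤ m ^ k := pow_le_pow_of_le_one hm0 hm1 (by omega)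
    calc m ^ (k + 2) * (|v| * |l|) ≤ m ^ k * (|v| * (B * z ^ k)) := by gcongr
      _ = _ := by ring
  have e : |v| ^ p * (m * z) ^ (k + 2) = m ^ (k + 2) * (|v| ^ p * z ^ (k + 2)) := by
    rw [mul_pow]; ring
  rw [e] at hy
  have c1 := (abs_le.1 a1).1
  have c2 := (abs_le.1 a2).1
  have e3 : |v| * ((k + 2 : ℝ) / T + B) * (m * z) ^ k = |v| * ((k + 2 : ℝ) / T) * (m * z) ^ k +
    |v| * B * (m * z) ^ k := by ring
  linarith

lemma core {N : ℕ} {p σ : ℝ} (hp1 : 1 < p) (hσ : 0 < σ)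
    {w : Eu N → ℝ} (hw : Continuous w)
    (u : ℝ → Eu N → ℝ)
    (hcont : ContinuousOn (fun q : ℝ × Eu N => u q.1 q.2) (Set.Ici 0 ×ˢ Set.univ))
    (hx : ∀ t : ℝ, 0 < t → ContDiff ℝ 2 (u t))
    (hpde : ∀ t : ℝ, 0 < t → ∀ x : Eu N,
      HasDerivAt (fun τ : ℝ => u τ x) (lap (u t) x + |u t x| ^ p + t ^ σ * w x) t)
    {k : ℕ} (hk : 2 ≤ k * (p - 1)) {ξ : Eu N → ℝ} {C : ℝ} (hC : 0 ≤ C) (hξ : ContDiff ℝ 2 ξ)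
    (h0 : ∀ x, 0 ≤ ξ x) (h1 : ∀ x, ξ x ≤ 1) (h2 : ∀ x, 2 ≤ ‖x‖ → ξ x = 0)
    (hlap : ∀ R : ℝ, ∀ x,
      |lap (fun y => ξ (R⁻¹ • y) ^ (k + 2)) x| ≤ C * R⁻¹ ^ 2 * ξ (R⁻¹ • x) ^ k)
    {R T : ℝ} (hR : 0 < R) (hT : 0 < T) :
    (∫ s in (0:ℝ)..1, (s * (1 - s)) ^ (k + 2) * s ^ σ) * T ^ σ *
      (∫ x, w x * ξ (R⁻¹ • x) ^ (k + 2)) ≤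
    ((k + 2 : ℝ) / T + C * R⁻¹ ^ 2) ^ (p / (p - 1)) *
      volume.real (Metric.closedBall (0 : Eu N) (2 * R)) := by
  set Ξ : Eu N → ℝ := fun x => ξ (R⁻¹ • x) ^ (k + 2) with hΞdef
  have hΞ : ContDiff ℝ 2 Ξ := (hξ.comp (contDiff_const_smul R⁻¹)).pow _
  have hk0 : k ≠ 0 := by rintro rfl; norm_num at hk
  have hξ0 : ∀ x, x ∉ Metric.closedBall (0 : Eu N) (2 * R) → ξ (R⁻¹ • x) = 0 := by
    intro x hx
    apply h2
    rw [mem_closedBall_zero_iff, not_le] at hx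
    rw [norm_smul, norm_inv, Real.norm_eq_abs, abs_of_pos hR, inv_mul_eq_div, le_div_iff₀ hR]
    exact hx.le
  have hΞ0 : ∀ x, x ∉ Metric.closedBall (0 : Eu N) (2 * R) → Ξ x = 0 := by
    intro x hx
    simp only [hΞdef, hξ0 x hx]
    exact zero_pow (by omega)
  have hKc : IsCompact (Metric.closedBall (0 : Eu N) (2 * R)) := isCompact_closedBall _ _
  have hs : HasCompactSupport Ξ := HasCompactSupport.intro hKc hΞ0
  have hts : tsupport Ξ ⊆ Metric.closedBall (0 : Eu N) (2 * R) := by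
    refine closure_minimal ?_ Metric.isClosed_closedBall
    intro x hx
    by_contra h
    exact hx (hΞ0 x h)
  have hbox : tsupport Ξ ⊆ box N ((4 * R) / 2) := by
    intro x hx i
    have h3 := hts hx
    rw [mem_closedBall_zero_iff] at h3
    have h4 := PiLp.norm_apply_le x i
    rw [Real.norm_eq_abs] at h4
    linarith
  have hlc : Continuous (lap Ξ) := lap_continuous hΞ
  have hls : HasCompactSupport (lap Ξ) :=
    HasCompactSupport.intro hs fun x hx => lap_zero_of_notMem hΞ hx
  have hlap' : ∀ x, |lap Ξ x| ≤ C * R⁻¹ ^ 2 * ξ (R⁻¹ • x) ^ k := hlap R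
  have hl0 : ∀ x, x ∉ Metric.closedBall (0 : Eu N) (2 * R) → lap Ξ x = 0 := fun x hx =>
    lap_zero_of_notMem hΞ fun h => hx (hts h)
  have huT : ContinuousOn (fun q : ℝ × Eu N => u q.1 q.2) (Icc 0 T ×ˢ univ) :=
    hcont.mono (prod_mono Icc_subset_Ici_self le_rfl)
  have hupT : ContinuousOn (fun q : ℝ × Eu N => |u q.1 q.2| ^ p) (Icc 0 T ×ˢ univ) :=
    huT.abs.rpow_const fun _ _ => Or.inr (by linarith)
  have hfT : ContinuousOn (fun q : ℝ × Eu N => |u q.1 q.2| ^ p + q.1 ^ σ * w q.2)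
      (Icc 0 T ×ˢ univ) := by
    refine hupT.add (ContinuousOn.mul ?_ (hw.comp continuous_snd).continuousOn)
    exact continuous_fst.continuousOn.rpow_const fun _ _ => Or.inr hσ.le
  set f : ℝ → Eu N → ℝ := fun t x => |u t x| ^ p + t ^ σ * w x with hf
  set F : ℝ → ℝ := fun t => ∫ x, u t x * Ξ x with hF
  set G : ℝ → ℝ := fun t => (∫ x, u t x * lap Ξ x) + ∫ x, f t x * Ξ x with hG
  have hFc : ContinuousOn F (Icc 0 T) := param_cont huT hΞ.continuous hs
  have hGc : ContinuousOn G (Icc 0 T) :=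
    (param_cont huT hlc hls).add (param_cont hfT hΞ.continuous hs)
  have hFG : ∀ b ∈ Ioo 0 T, F b = F 0 + ∫ t in (0:ℝ)..b, G t := by
    intro b hb
    have hsub : Icc 0 b ×ˢ (univ : Set (Eu N)) ⊆ Icc 0 T ×ˢ univ :=
      prod_mono (Icc_subset_Icc_right hb.2.le) le_rfl
    have := weak_form (L := 4 * R) hb.1 (by linarith) u f (huT.mono hsub) (hfT.mono hsub)
      (fun t ht => hx t ht.1) (fun t ht x => (hpde t ht.1 x).congr_deriv (by simp only [hf]; ring))
      hΞ hs hbox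
    rw [hG, ← this]
    simp only [hF]; ring
  have hFd : ∀ t ∈ Ioo 0 T, HasDerivAt F (G t) t := by
    intro t ht
    have hGo : ContinuousOn G (Ioo 0 T) := hGc.mono Ioo_subset_Icc_self
    have hi : IntervalIntegrable G volume 0 t :=
      (hGc.mono (Icc_subset_Icc_right ht.2.le)).intervalIntegrable_of_Icc ht.1.le
    have h3 := intervalIntegral.integral_hasDerivAt_right hi
      (hGo.stronglyMeasurableAtFilter isOpen_Ioo t ht) (hGo.continuousAt (isOpen_Ioo.mem_nhds ht))
    refine (h3.const_add (F 0)).congr_of_eventuallyEq ?_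
    filter_upwards [isOpen_Ioo.mem_nhds ht] with b hb
    exact hFG b hb
  -- time cutoff
  set m : ℝ → ℝ := fun t => t / T * (1 - t / T) with hm
  have hmd : ∀ t, HasDerivAt m (1 / T * (1 - 2 * (t / T))) t := by
    intro t
    have a1 : HasDerivAt (fun t : ℝ => t / T) (1 / T) t := (hasDerivAt_id t).div_const T
    have a2 : HasDerivAt (fun t : ℝ => 1 - t / T) (-(1 / T)) t := a1.const_sub 1
    refine (a1.mul a2).congr_deriv ?_
    ring
  set d : ℝ → ℝ := fun t => ((k + 2 : ℕ) : ℝ) * m t ^ (k + 1) * (1 / T * (1 - 2 * (t / T))) with hd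
  have hηd : ∀ t, HasDerivAt (fun t => m t ^ (k + 2)) (d t) t := by
    intro t
    exact (hmd t).pow (k + 2)
  have hmc : Continuous m := by fun_prop
  have hdc : Continuous d := by fun_prop
  have hHc : ContinuousOn (fun t => d t * F t + m t ^ (k + 2) * G t) (Icc 0 T) :=
    (hdc.continuousOn.mul hFc).add ((hmc.pow _).continuousOn.mul hGc)
  have hzero : ∫ t in (0:ℝ)..T, (d t * F t + m t ^ (k + 2) * G t) = 0 := by
    have h3 := intervalIntegral.integral_eq_sub_of_hasDerivAt_of_le (a := 0) (b := T) hT.le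
      (f := fun t => m t ^ (k + 2) * F t)
      (f' := fun t => d t * F t + m t ^ (k + 2) * G t)
      ((hmc.pow _).continuousOn.mul hFc) (fun t ht => (hηd t).mul (hFd t ht))
      (hHc.intervalIntegrable_of_Icc hT.le)
    rw [h3]
    have e1 : m T = 0 := by simp [hm, hT.ne']
    have e2 : m 0 = 0 := by simp [hm]
    rw [e1, e2]; simp
  set W := ∫ x, w x * Ξ x with hW
  set A := ((k + 2 : ℝ) / T + C * R⁻¹ ^ 2) ^ (p / (p - 1)) with hA
  set v := volume.real (Metric.closedBall (0 : Eu N) (2 * R)) with hv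
  have hlow : ∀ t ∈ Icc 0 T, -(A * v) + m t ^ (k + 2) * t ^ σ * W ≤
      d t * F t + m t ^ (k + 2) * G t := by
    intro t ht
    have hut := slice_cont huT ht
    have hupt := slice_cont (h := fun t x => |u t x| ^ p) hupT ht
    have i1 := (integrable_mul_cs hut hΞ.continuous hs).const_mul (d t)
    have i2 := (integrable_mul_cs hut hlc hls).const_mul (m t ^ (k + 2))
    have i3' := integrable_mul_cs hupt hΞ.continuous hs
    have i3 := i3'.const_mul (m t ^ (k + 2))
    have i4 := (integrable_mul_cs hw hΞ.continuous hs).const_mul (t ^ σ)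
    have i12 : Integrable (fun x => d t * (u t x * Ξ x) + m t ^ (k + 2) * (u t x * lap Ξ x)) :=
      i1.add i2
    have ef : ∫ x, f t x * Ξ x = (∫ x, |u t x| ^ p * Ξ x) + t ^ σ * W := by
      rw [hW, ← integral_const_mul, ← integral_add i3' i4]
      refine integral_congr_ae (Eventually.of_forall fun x => ?_)
      simp only [hf]; ring
    have et : d t * F t + m t ^ (k + 2) * G t = (∫ x, (d t * (u t x * Ξ x) +
        m t ^ (k + 2) * (u t x * lap Ξ x) + m t ^ (k + 2) * (|u t x| ^ p * Ξ x))) +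
        m t ^ (k + 2) * t ^ σ * W := by
      rw [integral_add i12 i3, integral_add i1 i2, integral_const_mul,
        integral_const_mul, integral_const_mul]
      simp only [hG, hF, ef]; ring
    rw [et]
    refine add_le_add ?_ le_rfl
    have eA : -(A * v) = ∫ x, (Metric.closedBall (0 : Eu N) (2 * R)).indicator (fun _ => -A) x := by
      rw [integral_indicator_const _ hKc.measurableSet]
      simp [hv]; ring
    rw [eA]
    refine integral_mono ((integrable_indicator_iff hKc.measurableSet).2
      (integrableOn_const hKc.measure_ne_top)) (i12.add i3) fun x => ?_
    have s0 : 0 ≤ t / T := div_nonneg ht.1 hT.le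
    have s1 : t / T ≤ 1 := (div_le_one hT).2 ht.2
    by_cases hxK : x ∈ Metric.closedBall (0 : Eu N) (2 * R)
    · rw [indicator_of_mem hxK]
      refine pointwise (m := m t) (m' := 1 / T * (1 - 2 * (t / T))) (z := ξ (R⁻¹ • x)) hp1 hk hT
        ?_ ?_ (h0 _) (h1 _) (by positivity) ?_ (hlap' x) rfl
      · exact mul_nonneg s0 (by linarith)
      · exact mul_le_one₀ s1 (by linarith) (by linarith)
      · rw [abs_mul, abs_of_pos (by positivity : 0 < 1 / T)]
        refine mul_le_of_le_one_right (by positivity) ?_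
        rw [abs_le]; constructor <;> linarith
    · rw [indicator_of_notMem hxK]
      simp [hΞ0 x hxK, hl0 x hxK]
  have hcont2 : Continuous fun t : ℝ => m t ^ (k + 2) * t ^ σ :=
    (hmc.pow _).mul (Real.continuous_rpow_const hσ.le)
  have hInt := intervalIntegral.integral_mono_on (μ := volume) hT.le
    ((by fun_prop : Continuous fun t : ℝ => -(A * v) + m t ^ (k + 2) * t ^ σ * W).intervalIntegrable 0 T)
    (hHc.intervalIntegrable_of_Icc hT.le) hlow
  have hii : IntervalIntegrable (fun t : ℝ => m t ^ (k + 2) * t ^ σ * W) volume 0 T :=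
    (hcont2.mul continuous_const).intervalIntegrable _ _
  rw [hzero, intervalIntegral.integral_add (by simp) hii,
    intervalIntegral.integral_const, intervalIntegral.integral_mul_const] at hInt
  have hsub : ∫ t in (0:ℝ)..T, m t ^ (k + 2) * t ^ σ =
      T ^ σ * (T * ∫ s in (0:ℝ)..1, (s * (1 - s)) ^ (k + 2) * s ^ σ) := by
    have h3 := intervalIntegral.integral_comp_div (a := 0) (b := T)
      (fun s => (s * (1 - s)) ^ (k + 2) * s ^ σ) hT.ne'
    rw [zero_div, div_self hT.ne', smul_eq_mul] at h3
    rw [← h3, ← intervalIntegral.integral_const_mul]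
    refine intervalIntegral.integral_congr fun t ht => ?_
    rw [uIcc_of_le hT.le] at ht
    simp only [hm]
    rw [Real.div_rpow ht.1 hT.le]
    have : T ^ σ ≠ 0 := (Real.rpow_pos_of_pos hT σ).ne'
    field_simp
  rw [hsub, smul_eq_mul] at hInt
  have h5 : T * ((∫ s in (0:ℝ)..1, (s * (1 - s)) ^ (k + 2) * s ^ σ) * T ^ σ * W) ≤ T * (A * v) := by
    linarith
  exact le_of_mul_le_mul_left h5 hT

lemma add_rpow_le_two {a b q : ℝ} (ha : 0 ≤ a) (hb : 0 ≤ b) (hq : 0 ≤ q) :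
    (a + b) ^ q ≤ 2 ^ q * (a ^ q + b ^ q) := by
  have ha' := Real.rpow_nonneg ha q
  have hb' := Real.rpow_nonneg hb q
  rcases le_total a b with h | h
  · calc (a + b) ^ q ≤ (2 * b) ^ q := Real.rpow_le_rpow (by positivity) (by linarith) hq
      _ = 2 ^ q * b ^ q := Real.mul_rpow (by norm_num) hb
      _ ≤ _ := by gcongr; linarith
  · calc (a + b) ^ q ≤ (2 * a) ^ q := Real.rpow_le_rpow (by positivity) (by linarith) hq
      _ = 2 ^ q * a ^ q := Real.mul_rpow (by norm_num) ha
      _ ≤ _ := by gcongr; linarith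

lemma tendsto_cutoff {N n : ℕ} {w ξ : Eu N → ℝ} (hw : Continuous w) (hwI : Integrable w)
    (hξ : Continuous ξ) (h0 : ∀ x, 0 ≤ ξ x) (h1 : ∀ x, ξ x ≤ 1) (h2 : ∀ x, ‖x‖ ≤ 1 → ξ x = 1) :
    Tendsto (fun R : ℝ => ∫ x, w x * ξ (R⁻¹ • x) ^ n) atTop (nhds (∫ x, w x)) := by
  refine tendsto_integral_filter_of_dominated_convergence (fun x => ‖w x‖) ?_ ?_ hwI.norm ?_
  · exact Eventually.of_forall fun R =>
      (hw.mul ((hξ.comp (continuous_const_smul R⁻¹)).pow n)).aestronglyMeasurable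
  · refine Eventually.of_forall fun R => Eventually.of_forall fun x => ?_
    rw [norm_mul]
    refine mul_le_of_le_one_right (norm_nonneg _) ?_
    rw [Real.norm_eq_abs, abs_of_nonneg (pow_nonneg (h0 _) _)]
    exact pow_le_one₀ (h0 _) (h1 _)
  · refine Eventually.of_forall fun x => ?_
    refine tendsto_const_nhds.congr' ?_
    filter_upwards [eventually_ge_atTop ‖x‖, eventually_gt_atTop 0] with R hR hR0
    have : ξ (R⁻¹ • x) = 1 := by
      apply h2
      rw [norm_smul, norm_inv, Real.norm_eq_abs, abs_of_pos hR0, inv_mul_eq_div]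
      exact (div_le_one hR0).2 hR
    simp [this]

/-- The key two-parameter test-function inequality for global classical solutions, σ > 0:
∫ w ≤ C (T^{−σ} R^{N−2p/(p−1)} + T^{−p/(p−1)−σ} R^N) for all large R and all T > 0. -/
theorem test_function_inequality_global_solution_pos_sigma
    (N : ℕ) (hN : 2 ≤ N) (p σ : ℝ) (hp1 : 1 < p) (hσ : 0 < σ)
    (u₀ : Eu N → ℝ) (hu₀ : IsC0 u₀)
    (w : Eu N → ℝ) (hwC : IsC0 w) (hwI : Integrable w) (hwpos : 0 < ∫ x, w x)
    (u : ℝ → Eu N → ℝ)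
    (hcont : ContinuousOn (fun q : ℝ × Eu N => u q.1 q.2) (Set.Ici 0 ×ˢ Set.univ))
    (hx : ∀ t : ℝ, 0 < t → ContDiff ℝ 2 (u t))
    (hderiv : ∀ x : Eu N, ContinuousOn (fun t : ℝ => deriv (fun τ : ℝ => u τ x) t) (Set.Ioi 0))
    (hpde : ∀ t : ℝ, 0 < t → ∀ x : Eu N,
      HasDerivAt (fun τ : ℝ => u τ x) (lap (u t) x + |u t x| ^ p + t ^ σ * w x) t)
    (hinit : u 0 = u₀) :
    ∃ C > (0 : ℝ), ∃ R₀ > (0 : ℝ), ∀ R : ℝ, R₀ ≤ R → ∀ T : ℝ, 0 < T →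
      (∫ x, w x) ≤ C * (T ^ (-σ) * R ^ ((N : ℝ) - 2 * p / (p - 1))
        + T ^ (-(p / (p - 1)) - σ) * R ^ (N : ℝ)) := by
  have hp0 : 0 < p - 1 := by linarith
  obtain ⟨k, hk'⟩ := exists_nat_ge (2 / (p - 1))
  have hk : 2 ≤ k * (p - 1) := (div_le_iff₀ hp0).1 hk'
  obtain ⟨ξ, C, hC, hξ, h0, h1, h2, h3, hlap⟩ := exists_test N k
  set c := ∫ s in (0:ℝ)..1, (s * (1 - s)) ^ (k + 2) * s ^ σ with hc
  have hcpos : 0 < c := by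
    refine intervalIntegral.intervalIntegral_pos_of_pos_on ?_ ?_ one_pos
    · refine Continuous.intervalIntegrable ?_ _ _
      exact (by fun_prop : Continuous fun s : ℝ => (s * (1 - s)) ^ (k + 2)).mul
        (Real.continuous_rpow_const hσ.le)
    · intro s hs
      have a1 : 0 < s := hs.1
      have a2 : 0 < 1 - s := by linarith [hs.2]
      positivity
  have hlim := tendsto_cutoff (n := k + 2) hwC.1 hwI hξ.continuous h0 h1 h2
  obtain ⟨R₁, hR₁⟩ := eventually_atTop.1 (hlim.eventually (lt_mem_nhds (half_lt_self hwpos)))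
  set q := p / (p - 1) with hq
  have hq0 : 0 < q := by positivity
  set v1 := volume.real (Metric.ball (0 : Eu N) 1) with hv1
  have hv1pos : 0 < v1 := by
    rw [hv1, measureReal_def]
    exact ENNReal.toReal_pos (Metric.measure_ball_pos volume _ one_pos).ne'
      measure_ball_lt_top.ne
  set D := (k + 2 : ℝ) + C with hD
  have hDpos : 0 < D := by positivity
  refine ⟨2 / c * (D ^ q * 2 ^ q) * (2 ^ N * v1), by positivity, max R₁ 1,
    lt_max_of_lt_right one_pos, fun R hR T hT => ?_⟩
  have hR0 : 0 < R := one_pos.trans_le ((le_max_right _ _).trans hR)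
  have hcore := core hp1 hσ hwC.1 u hcont hx hpde hk hC hξ h0 h1 h3 hlap hR0 hT
  have hW := hR₁ R ((le_max_left _ _).trans hR)
  have hvol : volume.real (Metric.closedBall (0 : Eu N) (2 * R)) = (2 * R) ^ N * v1 := by
    rw [measureReal_def, Measure.addHaar_closedBall _ _ (by positivity), finrank_euclideanSpace,
      Fintype.card_fin, ENNReal.toReal_mul, ENNReal.toReal_ofReal (by positivity)]
    rfl
  have hAle : ((k + 2 : ℝ) / T + C * R⁻¹ ^ 2) ^ q ≤
      D ^ q * 2 ^ q * (T ^ (-q) + R ^ (-(2 * q))) := by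
    have b1 : (k + 2 : ℝ) / T + C * R⁻¹ ^ 2 ≤ D * (T⁻¹ + R⁻¹ ^ 2) := by
      have e1 : 0 ≤ C * T⁻¹ := by positivity
      have e2 : 0 ≤ (k + 2 : ℝ) * R⁻¹ ^ 2 := by positivity
      rw [div_eq_mul_inv, hD]
      nlinarith
    have b2 : (T⁻¹) ^ q = T ^ (-q) := by rw [Real.inv_rpow hT.le, Real.rpow_neg hT.le]
    have b3 : (R⁻¹ ^ 2) ^ q = R ^ (-(2 * q)) := by
      rw [← Real.rpow_natCast, ← Real.rpow_mul (by positivity), Real.inv_rpow hR0.le,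
        Real.rpow_neg hR0.le]
      norm_num
    calc _ ≤ (D * (T⁻¹ + R⁻¹ ^ 2)) ^ q := Real.rpow_le_rpow (by positivity) b1 hq0.le
      _ = D ^ q * (T⁻¹ + R⁻¹ ^ 2) ^ q := Real.mul_rpow hDpos.le (by positivity)
      _ ≤ D ^ q * (2 ^ q * ((T⁻¹) ^ q + (R⁻¹ ^ 2) ^ q)) := by
          gcongr
          exact add_rpow_le_two (by positivity) (by positivity) hq0.le
      _ = _ := by rw [b2, b3]; ring
  rw [hvol] at hcore
  have hTσ : 0 < T ^ σ := Real.rpow_pos_of_pos hT σ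
  have key : c * T ^ σ * ((∫ x, w x) / 2) ≤
      D ^ q * 2 ^ q * (T ^ (-q) + R ^ (-(2 * q))) * ((2 * R) ^ N * v1) :=
    calc _ ≤ c * T ^ σ * (∫ x, w x * ξ (R⁻¹ • x) ^ (k + 2)) := by gcongr
      _ ≤ _ := hcore
      _ ≤ _ := by gcongr
  have r1 : R ^ ((N : ℝ) - 2 * p / (p - 1)) = R ^ N * R ^ (-(2 * q)) := by
    rw [← Real.rpow_natCast, ← Real.rpow_add hR0]
    congr 1
    rw [hq]; ring
  have r2 : T ^ (-q - σ) = T ^ (-q) * T ^ (-σ) := by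
    rw [← Real.rpow_add hT]; rfl
  have r3 : T ^ (-σ) = (T ^ σ)⁻¹ := Real.rpow_neg hT.le σ
  rw [r1, r2, r3, Real.rpow_natCast]
  have e : 2 / c * (D ^ q * 2 ^ q) * (2 ^ N * v1) * ((T ^ σ)⁻¹ * (R ^ N * R ^ (-(2 * q))) +
      T ^ (-q) * (T ^ σ)⁻¹ * R ^ N) =
      (D ^ q * 2 ^ q * (T ^ (-q) + R ^ (-(2 * q))) * ((2 * R) ^ N * v1)) / (c * T ^ σ / 2) := by
    rw [mul_pow]
    field_simp
    ring
  rw [e, le_div_iff₀ (by positivity)]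
  linarith

end
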